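/- arXiv:1006.3430 — 7 statements merged into one kernel-verified Lean document; each statement's English description precedes it below -/
import Mathlib

section
/- There is an absolute constant C such that for every hypercube graph G=H_{log n} on n=2^d vertices (d ≥ 1), the deterministic edge cover time satisfies ẼC(G) ≤ C·κ̃·n·(log n)². -/
/-- A rotor configuration on `G`: each vertex `u` carries a rotor sequence of length `d u`
(encoded as a `(d u)`-periodic map `s u : ℕ → V`) consisting of neighbors of `u`, in which
every neighbor of `u` occurs exactly `d u / deg u` times, together with an initial rotor
position `r0 u`. -/
structure RotorConfig {V : Type*} [Fintype V] [DecidableEq V]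
    (G : SimpleGraph V) [DecidableRel G.Adj] where
  d : V → ℕ
  d_pos : ∀ u, 0 < d u
  s : V → ℕ → V
  periodic : ∀ u i, s u (i + d u) = s u i
  adj : ∀ u i, i < d u → G.Adj u (s u i)
  count : ∀ u v, G.Adj u v →
    ((Finset.range (d u)).filter (fun i => s u i = v)).card = d u / G.degree u
  r0 : V → ℕ

namespace RotorConfig

variable {V : Type*} [Fintype V] [DecidableEq V] {G : SimpleGraph V} [DecidableRel G.Adj]

/-- `κ̃ = max_u d̃(u)/deg(u)`. -/
def kappa (cfg : RotorConfig G) : ℕ :=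
  Finset.univ.sup fun u => cfg.d u / G.degree u

/-- One step of the rotor walk; a state is a pair (current vertex, rotor positions). -/
def step (cfg : RotorConfig G) (st : V × (V → ℕ)) : V × (V → ℕ) :=
  (cfg.s st.1 (st.2 st.1), Function.update st.2 st.1 (st.2 st.1 + 1))

/-- The state of the rotor walk started at `x0` after `t` steps. -/
def state (cfg : RotorConfig G) (x0 : V) : ℕ → V × (V → ℕ)
  | 0 => (x0, cfg.r0)
  | t + 1 => cfg.step (state cfg x0 t)

/-- The position of the rotor walk started at `x0` after `t` steps. -/
def pos (cfg : RotorConfig G) (x0 : V) (t : ℕ) : V := (cfg.state x0 t).1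

/-- Every edge of `G` is traversed (in some direction) within the first `t` steps of the
rotor walk started at `x0`. -/
def coversEdges (cfg : RotorConfig G) (x0 : V) (t : ℕ) : Prop :=
  ∀ u v : V, G.Adj u v → ∃ ℓ, 1 ≤ ℓ ∧ ℓ ≤ t ∧
    ((cfg.pos x0 (ℓ - 1) = u ∧ cfg.pos x0 ℓ = v) ∨
     (cfg.pos x0 (ℓ - 1) = v ∧ cfg.pos x0 ℓ = u))

end RotorConfig

/-- Two vertices of the hypercube `{0,1}^d` are adjacent iff their bitstrings differ in
exactly one bit. -/
def CubeAdj (d : ℕ) (x y : Fin d → Bool) : Prop :=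
  ∃ i : Fin d, x i ≠ y i ∧ ∀ j : Fin d, j ≠ i → x j = y j

namespace RotorConfig

variable {V : Type*} [Fintype V] [DecidableEq V] {G : SimpleGraph V} [DecidableRel G.Adj]

/-- Number of exits from `u` in the first `t` steps. -/
def exits (cfg : RotorConfig G) (x0 : V) : ℕ → V → ℕ
  | 0 => fun _ => 0
  | t + 1 => Function.update (exits cfg x0 t) (cfg.pos x0 t) (exits cfg x0 t (cfg.pos x0 t) + 1)

lemma state_snd (cfg : RotorConfig G) (x0 : V) (t : ℕ) (u : V) :
    (cfg.state x0 t).2 u = cfg.r0 u + cfg.exits x0 t u := by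
  induction t generalizing u with
  | zero => simp [state, exits]
  | succ t ih =>
    simp only [state, step, exits, pos, Function.update_apply]
    split_ifs with h
    · rw [ih, h]; omega
    · exact ih u

lemma pos_succ (cfg : RotorConfig G) (x0 : V) (t : ℕ) :
    cfg.pos x0 (t + 1) = cfg.s (cfg.pos x0 t)
      (cfg.r0 (cfg.pos x0 t) + cfg.exits x0 t (cfg.pos x0 t)) := by
  rw [← state_snd]; rfl

lemma sum_exits (cfg : RotorConfig G) (x0 : V) (t : ℕ) :
    ∑ u, cfg.exits x0 t u = t := by
  induction t with
  | zero => simp [exits]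
  | succ t ih =>
    simp only [exits]
    rw [Finset.sum_update_of_mem (Finset.mem_univ _)]
    rw [← Finset.add_sum_erase _ _ (Finset.mem_univ (cfg.pos x0 t))] at ih
    rw [← Finset.erase_eq]
    omega

lemma exists_time (cfg : RotorConfig G) (x0 : V) (t : ℕ) (u : V) (i : ℕ)
    (hi : i < cfg.exits x0 t u) :
    ∃ l, l < t ∧ cfg.pos x0 l = u ∧ cfg.pos x0 (l + 1) = cfg.s u (cfg.r0 u + i) := by
  induction t with
  | zero => simp [exits] at hi
  | succ t ih =>
    by_cases h : i < cfg.exits x0 t u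
    · obtain ⟨l, h1, h2⟩ := ih h
      exact ⟨l, by omega, h2⟩
    · simp only [exits, Function.update_apply] at hi
      split_ifs at hi with h'
      · subst h'
        have : i = cfg.exits x0 t (cfg.pos x0 t) := by omega
        subst this
        exact ⟨t, by omega, rfl, pos_succ cfg x0 t⟩
      · exact absurd hi h

lemma telescope (cfg : RotorConfig G) (x0 : V) (φ : V → ℝ) (t : ℕ) :
    φ (cfg.pos x0 t) - φ x0 =
      ∑ u, ∑ i ∈ Finset.range (cfg.exits x0 t u), (φ (cfg.s u (cfg.r0 u + i)) - φ u) := by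
  induction t with
  | zero => simp [exits, pos, state]
  | succ t ih =>
    have key : ∀ u, ∑ i ∈ Finset.range (cfg.exits x0 (t+1) u), (φ (cfg.s u (cfg.r0 u + i)) - φ u)
        = ∑ i ∈ Finset.range (cfg.exits x0 t u), (φ (cfg.s u (cfg.r0 u + i)) - φ u)
          + if u = cfg.pos x0 t then φ (cfg.pos x0 (t+1)) - φ (cfg.pos x0 t) else 0 := by
      intro u
      simp only [exits, Function.update_apply]
      split_ifs with h
      · subst h
        rw [Finset.sum_range_succ, ← pos_succ]
      · simp
    simp_rw [key]
    rw [Finset.sum_add_distrib, ← ih]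
    simp

lemma card_window (cfg : RotorConfig G) (u v : V) (h : G.Adj u v) (n : ℕ) :
    ((Finset.Ico n (n + cfg.d u)).filter (fun i => cfg.s u i = v)).card
      = cfg.d u / G.degree u := by
  have := Nat.filter_Ico_card_eq_of_periodic n (cfg.d u) (fun i => cfg.s u i = v)
    (fun i => by simp [cfg.periodic])
  rw [this, ← cfg.count u v h, Nat.count_eq_card_filter_range]

lemma adj_all (cfg : RotorConfig G) (u : V) (i : ℕ) : G.Adj u (cfg.s u i) := by
  have h : Function.Periodic (cfg.s u) (cfg.d u) := cfg.periodic u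
  have := cfg.adj u (i % cfg.d u) (Nat.mod_lt _ (cfg.d_pos u))
  rwa [h.map_mod_nat] at this

lemma d_eq (cfg : RotorConfig G) (u : V) :
    cfg.d u = G.degree u * (cfg.d u / G.degree u) := by
  have := Finset.card_eq_sum_card_fiberwise (s := Finset.range (cfg.d u))
    (t := G.neighborFinset u) (f := cfg.s u)
    (fun i _ => by simpa using cfg.adj_all u i)
  rw [Finset.card_range] at this
  conv_lhs => rw [this]
  rw [Finset.sum_congr rfl (fun v hv => cfg.count u v (by simpa using hv))]
  simp

/-- number of times among the first `N` exits of `u` that the walk goes to `v`. -/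
def trav (cfg : RotorConfig G) (u v : V) (N : ℕ) : ℕ :=
  ((Finset.Ico (cfg.r0 u) (cfg.r0 u + N)).filter (fun i => cfg.s u i = v)).card

lemma trav_add (cfg : RotorConfig G) (u v : V) (h : G.Adj u v) (N : ℕ) :
    cfg.trav u v (N + cfg.d u) = cfg.trav u v N + cfg.d u / G.degree u := by
  unfold trav
  rw [← cfg.card_window u v h (cfg.r0 u + N), ← Finset.card_union_of_disjoint,
    ← Finset.filter_union, Finset.Ico_union_Ico_eq_Ico (by omega) (by omega), add_assoc]
  apply Finset.disjoint_filter_filter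
  exact Finset.Ico_disjoint_Ico_consecutive _ _ _

lemma trav_mul (cfg : RotorConfig G) (u v : V) (h : G.Adj u v) (q : ℕ) :
    cfg.trav u v (q * cfg.d u) = q * (cfg.d u / G.degree u) := by
  induction q with
  | zero => simp [trav]
  | succ q ih => rw [add_mul, one_mul, trav_add _ _ _ h, ih]; ring

lemma trav_mono (cfg : RotorConfig G) (u v : V) : Monotone (cfg.trav u v) := by
  intro a b hab
  apply Finset.card_le_card
  apply Finset.filter_subset_filter
  exact Finset.Ico_subset_Ico_right (by omega)

lemma d_le_kappa (cfg : RotorConfig G) (u : V) : cfg.d u / G.degree u ≤ cfg.kappa :=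
  Finset.le_sup (f := fun u => cfg.d u / G.degree u) (Finset.mem_univ u)

lemma abs_trav (cfg : RotorConfig G) (u v : V) (h : G.Adj u v) (N : ℕ) :
    |(cfg.trav u v N : ℝ) - N / G.degree u| ≤ cfg.kappa := by
  set k := cfg.d u / G.degree u with hk
  have hd : cfg.d u = G.degree u * k := cfg.d_eq u
  have hdeg : 0 < G.degree u := by
    rw [SimpleGraph.degree_pos_iff_exists_adj]; exact ⟨v, h⟩
  have hkk : (k : ℝ) ≤ cfg.kappa := by exact_mod_cast cfg.d_le_kappa u
  obtain ⟨q, hq1, hq2⟩ : ∃ q, q * cfg.d u ≤ N ∧ N ≤ (q + 1) * cfg.d u :=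
    ⟨N / cfg.d u, Nat.div_mul_le_self _ _, by
      have := Nat.div_add_mod N (cfg.d u)
      have h2 := Nat.mod_lt N (cfg.d_pos u)
      rw [add_mul, one_mul, mul_comm]; omega⟩
  have h1 := cfg.trav_mono u v hq1
  have h2 := cfg.trav_mono u v hq2
  rw [trav_mul _ _ _ h, ← hk] at h1 h2
  rw [hd] at hq1 hq2
  have hD : (0:ℝ) < G.degree u := by exact_mod_cast hdeg
  have h1' : (q * k : ℝ) ≤ cfg.trav u v N := by exact_mod_cast h1
  have h2' : (cfg.trav u v N : ℝ) ≤ (q + 1) * k := by exact_mod_cast h2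
  have h3 : (q * k : ℝ) ≤ N / G.degree u := by
    rw [le_div_iff₀ hD]
    have : (q * (G.degree u * k) : ℝ) ≤ N := by exact_mod_cast hq1
    linarith
  have h4 : (N / G.degree u : ℝ) ≤ (q + 1) * k := by
    rw [div_le_iff₀ hD]
    have : (N : ℝ) ≤ (q + 1) * (G.degree u * k) := by exact_mod_cast hq2
    linarith
  rw [abs_le]
  constructor <;> linarith

lemma sum_rotor (cfg : RotorConfig G) (u : V) (ψ : V → ℝ) (N : ℕ) :
    ∑ i ∈ Finset.range N, ψ (cfg.s u (cfg.r0 u + i)) =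
      ∑ v ∈ G.neighborFinset u, cfg.trav u v N * ψ v := by
  rw [Finset.range_eq_Ico, Finset.sum_Ico_add (fun i => ψ (cfg.s u i)) 0 N (cfg.r0 u)]
  rw [← Finset.sum_fiberwise_of_maps_to (t := G.neighborFinset u) (g := cfg.s u)
    (fun i _ => by simpa using cfg.adj_all u i)]
  apply Finset.sum_congr rfl
  intro v _
  rw [Finset.sum_congr rfl (g := fun _ => ψ v)]
  · simp [trav, add_comm]
  · intro i hi
    rw [(Finset.mem_filter.1 hi).2]

lemma sum_rotor_le (cfg : RotorConfig G) (u : V) (ψ : V → ℝ) (N : ℕ) :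
    ∑ i ∈ Finset.range N, ψ (cfg.s u (cfg.r0 u + i)) ≤
      N / G.degree u * ∑ v ∈ G.neighborFinset u, ψ v
        + cfg.kappa * ∑ v ∈ G.neighborFinset u, |ψ v| := by
  rw [sum_rotor, Finset.mul_sum, Finset.mul_sum, ← Finset.sum_add_distrib]
  apply Finset.sum_le_sum
  intro v hv
  have h := cfg.abs_trav u v (by simpa using hv) N
  have h2 : (cfg.trav u v N - N / G.degree u : ℝ) * ψ v ≤ cfg.kappa * |ψ v| := by
    refine (le_abs_self _).trans ?_
    rw [abs_mul]
    gcongr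
  linarith

lemma exists_window (cfg : RotorConfig G) (u v : V) (h : G.Adj u v) (N : ℕ) (hN : cfg.d u ≤ N) :
    ∃ i < N, cfg.s u (cfg.r0 u + i) = v := by
  have hpos : 0 < cfg.d u / G.degree u := by
    rcases Nat.eq_zero_or_pos (cfg.d u / G.degree u) with h0 | h0
    · have := cfg.d_eq u
      have h3 := cfg.d_pos u
      rw [h0] at this; omega
    · exact h0
  rw [← cfg.card_window u v h (cfg.r0 u), Finset.card_pos] at hpos
  obtain ⟨j, hj⟩ := hpos
  simp only [Finset.mem_filter, Finset.mem_Ico] at hj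
  refine ⟨j - cfg.r0 u, by omega, ?_⟩
  rw [show cfg.r0 u + (j - cfg.r0 u) = j by omega]; exact hj.2

lemma kappa_pos (cfg : RotorConfig G) (u : V) : 1 ≤ cfg.kappa := by
  refine le_trans ?_ (cfg.d_le_kappa u)
  by_contra h
  have := cfg.d_eq u
  have h3 := cfg.d_pos u
  rw [show cfg.d u / G.degree u = 0 from Nat.lt_one_iff.1 (not_le.1 h)] at this
  omega

end RotorConfig

namespace CubeAux

/-- flip a bit. -/
def flip {d : ℕ} (u : Fin d → Bool) (i : Fin d) : Fin d → Bool := Function.update u i (!u i)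

lemma flip_flip {d : ℕ} (u : Fin d → Bool) (i : Fin d) : flip (flip u i) i = u := by
  simp [flip]

lemma flip_inj {d : ℕ} (u : Fin d → Bool) : Function.Injective (flip u) := by
  intro i j h
  by_contra hij
  have := congrFun h i
  simp [flip, hij] at this

lemma sum_flip {d : ℕ} (i : Fin d) (f : (Fin d → Bool) → ℝ) : ∑ u, f (flip u i) = ∑ u, f u :=
  Function.Bijective.sum_comp
    (Function.Involutive.bijective (f := fun u => flip u i) (fun u => flip_flip u i)) f

lemma neighborFinset_eq {d : ℕ} (G : SimpleGraph (Fin d → Bool)) [DecidableRel G.Adj]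
    (hG : ∀ x y, G.Adj x y ↔ CubeAdj d x y) (u : Fin d → Bool) :
    G.neighborFinset u = Finset.univ.image (flip u) := by
  ext v
  simp only [SimpleGraph.mem_neighborFinset, hG, CubeAdj, Finset.mem_image, Finset.mem_univ,
    true_and]
  constructor
  · rintro ⟨i, hi, h⟩
    refine ⟨i, ?_⟩
    ext j
    by_cases hj : j = i
    · subst hj; simp only [flip, Function.update_self]
      revert hi; cases u j <;> cases v j <;> simp
    · simp [flip, hj, h j hj]
  · rintro ⟨i, rfl⟩
    refine ⟨i, by simp [flip], fun j hj => by simp [flip, hj]⟩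

lemma sum_neighbor {d : ℕ} (G : SimpleGraph (Fin d → Bool)) [DecidableRel G.Adj]
    (hG : ∀ x y, G.Adj x y ↔ CubeAdj d x y) (u : Fin d → Bool) (ψ : (Fin d → Bool) → ℝ) :
    ∑ v ∈ G.neighborFinset u, ψ v = ∑ i, ψ (flip u i) := by
  rw [neighborFinset_eq G hG, Finset.sum_image (fun a _ b _ h => flip_inj u h)]

lemma degree_eq {d : ℕ} (G : SimpleGraph (Fin d → Bool)) [DecidableRel G.Adj]
    (hG : ∀ x y, G.Adj x y ↔ CubeAdj d x y) (u : Fin d → Bool) : G.degree u = d := by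
  rw [← SimpleGraph.card_neighborFinset_eq_degree, neighborFinset_eq G hG,
    Finset.card_image_of_injective _ (flip_inj u)]
  simp

/-- Hamming distance to `x`. -/
def lev {d : ℕ} (x u : Fin d → Bool) : ℕ := (Finset.univ.filter (fun i => u i ≠ x i)).card

lemma lev_flip_up {d : ℕ} (x u : Fin d → Bool) (i : Fin d) (h : u i = x i) :
    lev x (flip u i) = lev x u + 1 := by
  unfold lev
  rw [← Finset.card_insert_of_notMem (a := i) (s := Finset.univ.filter (fun i => u i ≠ x i))
    (by simp [h])]
  congr 1
  ext j
  by_cases hj : j = i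
  · subst hj; simp [flip, h]
  · rw [Finset.mem_filter, Finset.mem_insert, Finset.mem_filter]
    simp [flip, hj]

lemma lev_flip_down {d : ℕ} (x u : Fin d → Bool) (i : Fin d) (h : u i ≠ x i) :
    lev x (flip u i) + 1 = lev x u := by
  have := lev_flip_up x (flip u i) i (by
    simp only [flip, Function.update_self]; revert h; cases u i <;> cases x i <;> simp)
  rw [flip_flip] at this
  exact this.symm

lemma lev_le {d : ℕ} (x u : Fin d → Bool) : lev x u ≤ d := by
  have := Finset.card_filter_le (Finset.univ : Finset (Fin d)) (fun i => u i ≠ x i)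
  simpa [lev] using this

lemma lev_pos {d : ℕ} (x u : Fin d → Bool) (h : u ≠ x) : 0 < lev x u := by
  unfold lev
  rw [Finset.card_pos]
  obtain ⟨i, hi⟩ := Function.ne_iff.1 h
  exact ⟨i, by simpa using hi⟩

lemma exists_lev {d : ℕ} (x : Fin d → Bool) (k : ℕ) (hk : k ≤ d) : ∃ u, lev x u = k := by
  induction k with
  | zero => exact ⟨x, by simp [lev]⟩
  | succ k ih =>
    obtain ⟨u, hu⟩ := ih (by omega)
    have : ∃ i, u i = x i := by
      by_contra! hc
      have : lev x u = d := by simp [lev, hc]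
      omega
    obtain ⟨i, hi⟩ := this
    exact ⟨flip u i, by rw [lev_flip_up x u i hi, hu]⟩

lemma exists_incr (d : ℕ) (hd : 1 ≤ d) : ∃ a : ℕ → ℝ, (∀ k, 0 ≤ a k) ∧
    ∀ k < d, ((k : ℝ) + 1) * a k = d + ((d : ℝ) - (k + 1)) * a (k + 1) := by
  let c : ℕ → ℝ := fun n => Nat.rec 1 (fun j cj => (d + (j + 1) * cj) / ((d - 1 - j : ℕ) : ℝ)) n
  have hc0 : c 0 = 1 := rfl
  have hcs : ∀ j, c (j + 1) = (d + (j + 1) * c j) / ((d - 1 - j : ℕ) : ℝ) := fun j => rfl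
  have hc : ∀ j, 0 ≤ c j := by
    intro j
    induction j with
    | zero => rw [hc0]; norm_num
    | succ j ih => rw [hcs]; positivity
  refine ⟨fun k => c (d - 1 - k), fun k => hc _, ?_⟩
  intro k hk
  rcases Nat.lt_or_ge (k + 1) d with h | h
  · obtain ⟨j, rfl⟩ : ∃ j, d = k + j + 2 := ⟨d - k - 2, by omega⟩
    simp only
    rw [show k + j + 2 - 1 - k = j + 1 by omega, show k + j + 2 - 1 - (k + 1) = j by omega, hcs,
      show k + j + 2 - 1 - j = k + 1 by omega]
    push_cast
    field_simp
    ring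
  · obtain rfl : d = k + 1 := by omega
    simp only
    rw [show k + 1 - 1 - k = 0 by omega, hc0]
    push_cast
    ring

lemma exists_potential (d : ℕ) (hd : 1 ≤ d) (x : Fin d → Bool) :
    ∃ φ : (Fin d → Bool) → ℝ, (∀ u, 0 ≤ φ u) ∧ (∀ u, φ u ≤ 2 * d ^ 2 * 2 ^ d) ∧
      (∀ u, u ≠ x → ∑ i, (φ (flip u i) - φ u) = -d) ∧
      (∑ i, (φ (flip x i) - φ x) = d * (2 ^ d - 1)) ∧
      ∑ u, ∑ i, |φ (flip u i) - φ u| ≤ 2 * d ^ 2 * 2 ^ d := by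
  obtain ⟨a, ha, hrec⟩ := exists_incr d hd
  let φ : (Fin d → Bool) → ℝ := fun u => ∑ j ∈ Finset.range (lev x u), a j
  have hup : ∀ u i, u i = x i → φ (flip u i) - φ u = a (lev x u) := by
    intro u i h
    simp only [φ, lev_flip_up x u i h, Finset.sum_range_succ]; ring
  have hdown : ∀ u i, u i ≠ x i → φ (flip u i) - φ u = - a (lev x u - 1) := by
    intro u i h
    simp only [φ, ← lev_flip_down x u i h, Finset.sum_range_succ, Nat.add_sub_cancel]; ring
  have hpos : ∀ u, 0 ≤ φ u := fun u => Finset.sum_nonneg (fun j _ => ha j)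
  have hoff : ∀ u, u ≠ x → ∑ i, (φ (flip u i) - φ u) = -d := by
    intro u hu
    have hl := lev_pos x u hu
    have hl2 := lev_le x u
    rw [← Finset.sum_filter_add_sum_filter_not Finset.univ (fun i => u i ≠ x i)]
    rw [Finset.sum_congr rfl (fun i hi => hdown u i (Finset.mem_filter.1 hi).2),
      Finset.sum_congr rfl (fun i hi => hup u i (not_not.1 (Finset.mem_filter.1 hi).2))]
    have hcard := Finset.card_filter_add_card_filter_not (s := (Finset.univ : Finset (Fin d)))
      (fun i => u i ≠ x i)
    rw [Finset.card_univ, Fintype.card_fin] at hcard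
    have hcard' : (lev x u : ℝ) +
        ((Finset.univ.filter (fun i => ¬ (u i ≠ x i))).card : ℝ) = d := by
      exact_mod_cast hcard
    have h1 : ((Finset.univ.filter (fun i => u i ≠ x i)).card : ℝ) = lev x u := rfl
    rw [Finset.sum_const, Finset.sum_const, nsmul_eq_mul, nsmul_eq_mul, h1]
    have := hrec (lev x u - 1) (by omega)
    rw [Nat.sub_add_cancel hl, Nat.cast_sub hl] at this
    push_cast at this
    rw [show ((Finset.univ.filter (fun i => ¬ (u i ≠ x i))).card : ℝ) = d - lev x u by linarith]
    linarith
  have htot : ∑ u, ∑ i, (φ (flip u i) - φ u) = 0 := by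
    rw [Finset.sum_comm]
    apply Finset.sum_eq_zero
    intro i _
    rw [Finset.sum_sub_distrib, sum_flip, sub_self]
  have hx : ∑ i, (φ (flip x i) - φ x) = d * (2 ^ d - 1) := by
    rw [← Finset.add_sum_erase _ _ (Finset.mem_univ x),
      Finset.sum_congr rfl (fun u hu => hoff u (Finset.ne_of_mem_erase hu))] at htot
    rw [Finset.sum_const, Finset.card_erase_of_mem (Finset.mem_univ _)] at htot
    simp only [Finset.card_univ, Fintype.card_fun, Fintype.card_bool, Fintype.card_fin,
      nsmul_eq_mul] at htot
    rw [Nat.cast_sub Nat.one_le_two_pow] at htot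
    push_cast at htot
    linarith
  have habs : ∀ u i, |φ (flip u i) - φ u| =
      (φ (flip u i) - φ u) * ((lev x (flip u i) : ℝ) - lev x u) := by
    intro u i
    by_cases h : u i = x i
    · rw [hup u i h, lev_flip_up x u i h, abs_of_nonneg (ha _)]; push_cast; ring
    · rw [hdown u i h, ← lev_flip_down x u i h, abs_neg, abs_of_nonneg (ha _)]; push_cast; ring
  have hB : ∑ u, ∑ i, |φ (flip u i) - φ u| ≤ 2 * d ^ 2 * 2 ^ d := by
    have e1 : ∑ u, ∑ i, |φ (flip u i) - φ u| =
        ∑ u, -2 * (lev x u * ∑ i, (φ (flip u i) - φ u)) := by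
      simp_rw [Finset.mul_sum]
      rw [Finset.sum_comm]
      conv_rhs => rw [Finset.sum_comm]
      apply Finset.sum_congr rfl
      intro i _
      simp_rw [habs, mul_sub]
      rw [Finset.sum_sub_distrib]
      have := sum_flip i (fun u => (φ (flip u i) - φ u) * (lev x (flip u i) : ℝ))
      simp only [flip_flip] at this
      rw [← this, ← Finset.sum_sub_distrib]
      apply Finset.sum_congr rfl
      intro u _
      ring
    rw [e1]
    have e2 : ∀ u ∈ (Finset.univ : Finset (Fin d → Bool)),
        -2 * (lev x u * ∑ i, (φ (flip u i) - φ u)) ≤ 2 * (d:ℝ) ^ 2 := by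
      intro u _
      by_cases hu : u = x
      · subst hu
        have : lev u u = 0 := by simp [lev]
        rw [this]; simp
      · rw [hoff u hu]
        have : (lev x u : ℝ) ≤ d := by exact_mod_cast lev_le x u
        nlinarith
    refine (Finset.sum_le_card_nsmul _ _ _ e2).trans (le_of_eq ?_)
    simp
    ring
  refine ⟨φ, hpos, ?_, hoff, hx, hB⟩
  intro u
  refine le_trans ?_ hB
  choose! w hw using exists_lev x
  calc φ u ≤ ∑ k ∈ Finset.range d, a k := by
        apply Finset.sum_le_sum_of_subset_of_nonneg
        · intro j hj
          have := lev_le x u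
          simp only [Finset.mem_range] at hj ⊢; omega
        · intro i _ _; exact ha i
    _ ≤ ∑ k ∈ Finset.range d, ∑ i, |φ (flip (w k) i) - φ (w k)| := by
        apply Finset.sum_le_sum
        intro k hk
        have hk' := Finset.mem_range.1 hk
        have h1 := hw k hk'.le
        have : ∃ i, (w k) i = x i := by
          by_contra! hc
          have : lev x (w k) = d := by simp [lev, hc]
          omega
        obtain ⟨i, hi⟩ := this
        have h2 := hup (w k) i hi
        rw [h1] at h2
        rw [← h2]
        exact (le_abs_self _).trans
          (Finset.single_le_sum (f := fun i => |φ (flip (w k) i) - φ (w k)|)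
            (fun i _ => abs_nonneg _) (Finset.mem_univ i))
    _ = ∑ v ∈ (Finset.range d).image w, ∑ i, |φ (flip v i) - φ v| := by
        rw [Finset.sum_image]
        intro k hk l hl h
        have h1 := hw k (Finset.mem_range.1 hk).le
        have h2 := hw l (Finset.mem_range.1 hl).le
        rw [← h1, ← h2, h]
    _ ≤ _ := by
        apply Finset.sum_le_sum_of_subset_of_nonneg (Finset.subset_univ _)
        intro v _ _
        exact Finset.sum_nonneg (fun i _ => abs_nonneg _)

lemma time_le (d : ℕ) (hd : 1 ≤ d) (G : SimpleGraph (Fin d → Bool)) [DecidableRel G.Adj]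
    (hG : ∀ x y, G.Adj x y ↔ CubeAdj d x y) (cfg : RotorConfig G) (x0 x : Fin d → Bool) (t : ℕ)
    (hx : cfg.exits x0 t x < cfg.d x) : t ≤ 5 * cfg.kappa * 2 ^ d * d ^ 2 := by
  obtain ⟨φ, h0, hM, hoff, hon, hB⟩ := exists_potential d hd x
  have hd0 : (0:ℝ) < d := by exact_mod_cast hd
  have hd1 : (1:ℝ) ≤ d := by exact_mod_cast hd
  have hκ : (1:ℝ) ≤ cfg.kappa := by exact_mod_cast cfg.kappa_pos x
  have htel := cfg.telescope x0 φ t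
  have hle : φ (cfg.pos x0 t) - φ x0 ≤ ∑ u, ((cfg.exits x0 t u : ℝ) / d *
      ∑ i, (φ (flip u i) - φ u) + cfg.kappa * ∑ i, |φ (flip u i) - φ u|) := by
    rw [htel]
    apply Finset.sum_le_sum
    intro u _
    have := cfg.sum_rotor_le u (fun v => φ v - φ u) (cfg.exits x0 t u)
    rw [sum_neighbor G hG, sum_neighbor G hG u (fun v => |φ v - φ u|), degree_eq G hG] at this
    exact this
  have hterm : ∀ u, (cfg.exits x0 t u : ℝ) / d * ∑ i, (φ (flip u i) - φ u) =
      -(cfg.exits x0 t u : ℝ) + if u = x then 2 ^ d * (cfg.exits x0 t x : ℝ) else 0 := by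
    intro u
    split_ifs with h
    · subst h; rw [hon]; field_simp; ring
    · rw [hoff u h]; field_simp; ring
  have hsum : ∑ u, (cfg.exits x0 t u : ℝ) = t := by exact_mod_cast cfg.sum_exits x0 t
  rw [Finset.sum_add_distrib, ← Finset.mul_sum] at hle
  simp_rw [hterm] at hle
  rw [Finset.sum_add_distrib, Finset.sum_neg_distrib, hsum] at hle
  simp only [Finset.sum_ite_eq', Finset.mem_univ, if_true] at hle
  have hN : (cfg.exits x0 t x : ℝ) ≤ d * cfg.kappa := by
    have h1 := cfg.d_eq x
    have h2 := cfg.d_le_kappa x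
    rw [degree_eq G hG] at h1 h2
    have : cfg.exits x0 t x ≤ d * cfg.kappa := by
      calc _ ≤ cfg.d x := hx.le
        _ = _ := h1
        _ ≤ _ := by gcongr
    exact_mod_cast this
  have h2d : (0:ℝ) < 2 ^ d := by positivity
  have e1 : (2:ℝ) ^ d * (cfg.exits x0 t x : ℝ) ≤ 2 ^ d * (d * cfg.kappa) := by gcongr
  have e1' : (2:ℝ) ^ d * (d * cfg.kappa) ≤ 2 ^ d * (d ^ 2 * cfg.kappa) := by
    gcongr; nlinarith
  have e2 : (cfg.kappa : ℝ) * ∑ u, ∑ i, |φ (flip u i) - φ u| ≤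
      cfg.kappa * (2 * d ^ 2 * 2 ^ d) := by gcongr
  have e3 : (2 * d ^ 2 * 2 ^ d : ℝ) ≤ cfg.kappa * (2 * d ^ 2 * 2 ^ d) :=
    le_mul_of_one_le_left (by positivity) hκ
  have e4 := hM x0
  have e5 := h0 (cfg.pos x0 t)
  have : (t : ℝ) ≤ 5 * cfg.kappa * 2 ^ d * d ^ 2 := by linarith
  exact_mod_cast this

end CubeAux

/-- There is an absolute constant `C` such that for every hypercube on
`n = 2^d` vertices (`d ≥ 1`), the deterministic edge cover time satisfies
`ẼC(G) ≤ C·κ̃·n·(log n)²`. -/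
theorem detEdgeCover_hypercube_le :
    ∃ C : ℝ, 0 < C ∧
      ∀ d : ℕ, 1 ≤ d →
        ∀ (G : SimpleGraph (Fin d → Bool)) [DecidableRel G.Adj],
          (∀ x y, G.Adj x y ↔ CubeAdj d x y) →
          ∀ (cfg : RotorConfig G) (x0 : Fin d → Bool),
            ∃ t : ℕ,
              (t : ℝ) ≤ C * (cfg.kappa : ℝ) * ((2 ^ d : ℕ) : ℝ) *
                (Real.logb 2 ((2 ^ d : ℕ) : ℝ)) ^ 2 ∧
              cfg.coversEdges x0 t := by
  refine ⟨6, by norm_num, ?_⟩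
  intro d hd G _ hG cfg x0
  have hκ := cfg.kappa_pos x0
  refine ⟨5 * cfg.kappa * 2 ^ d * d ^ 2 + 1, ?_, ?_⟩
  · have hlog : Real.logb 2 ((2 ^ d : ℕ) : ℝ) = d := by
      push_cast
      rw [Real.logb_pow]; simp
    rw [hlog]
    have : 5 * cfg.kappa * 2 ^ d * d ^ 2 + 1 ≤ 6 * cfg.kappa * 2 ^ d * d ^ 2 := by
      have h1 : 1 ≤ cfg.kappa * 2 ^ d * d ^ 2 :=
        Nat.one_le_iff_ne_zero.2 (by positivity)
      linarith
    exact_mod_cast this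
  · intro u v huv
    by_cases h : cfg.d u ≤ cfg.exits x0 (5 * cfg.kappa * 2 ^ d * d ^ 2 + 1) u
    · obtain ⟨i, hi, hs⟩ := cfg.exists_window u v huv _ h
      obtain ⟨l, hl, h1, h2⟩ := cfg.exists_time x0 _ u i hi
      exact ⟨l + 1, by omega, by omega, Or.inl ⟨by simpa using h1, by rw [h2, hs]⟩⟩
    · have := CubeAux.time_le d hd G hG cfg x0 u _ (not_le.1 h)
      omega
end

section
/- For every fixed integer k ≥ 2 there is a constant C_k such that for every complete k-ary tree G on n vertices (all leaves at the same depth log_k n − 1, the root having k children and every internal vertex having k children), the deterministic edge cover time satisfies ẼC(G) ≤ C_k·κ̃·n·log n. -/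
/-- The vertex set of the complete `k`-ary tree of depth `D`: a vertex is a pair of a depth
`i ≤ D` and a path of `i` child-labels from the root. -/
abbrev KaryTreeVertex (k D : ℕ) : Type := Σ i : Fin (D + 1), (Fin i.val → Fin k)

/-- Two vertices of the complete `k`-ary tree are adjacent iff one is the parent of the
other, i.e. their depths differ by one and the shallower path is a prefix of the deeper
one. -/
def KaryTreeAdj (k D : ℕ) (a b : KaryTreeVertex k D) : Prop :=
  (a.1.val + 1 = b.1.val ∧
    ∀ (t : ℕ) (h1 : t < a.1.val) (h2 : t < b.1.val), b.2 ⟨t, h2⟩ = a.2 ⟨t, h1⟩) ∨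
  (b.1.val + 1 = a.1.val ∧
    ∀ (t : ℕ) (h1 : t < a.1.val) (h2 : t < b.1.val), a.2 ⟨t, h1⟩ = b.2 ⟨t, h2⟩)

namespace RotorAux

open RotorConfig

section general
variable {V : Type*} [Fintype V] [DecidableEq V] {G : SimpleGraph V} [DecidableRel G.Adj]

/-- Number of traversals of `u → v` in the first `t` steps. -/
def trav (cfg : RotorConfig G) (x0 u v : V) : ℕ → ℕ
  | 0 => 0
  | t + 1 => trav cfg x0 u v t + if cfg.pos x0 t = u ∧ cfg.pos x0 (t + 1) = v then 1 else 0

/-- Number of departures from `u` in the first `t` steps. -/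
def dep (cfg : RotorConfig G) (x0 u : V) : ℕ → ℕ
  | 0 => 0
  | t + 1 => dep cfg x0 u t + if cfg.pos x0 t = u then 1 else 0

lemma state_snd (cfg : RotorConfig G) (x0 u : V) (t : ℕ) :
    (cfg.state x0 t).2 u = cfg.r0 u + dep cfg x0 u t := by
  induction t with
  | zero => simp [state, dep]
  | succ t ih =>
    simp only [state, step, dep, pos]
    by_cases h : (cfg.state x0 t).1 = u
    · subst h; simp [ih]; ring
    · rw [Function.update_of_ne (Ne.symm h), ih]; simp [h]

lemma pos_succ (cfg : RotorConfig G) (x0 : V) (t : ℕ) :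
    cfg.pos x0 (t + 1) =
      cfg.s (cfg.pos x0 t) (cfg.r0 (cfg.pos x0 t) + dep cfg x0 (cfg.pos x0 t) t) := by
  rw [← state_snd]; rfl

lemma trav_eq_count (cfg : RotorConfig G) (x0 u v : V) (t : ℕ) :
    trav cfg x0 u v t = Nat.count (fun i => cfg.s u (cfg.r0 u + i) = v) (dep cfg x0 u t) := by
  induction t with
  | zero => simp [trav, dep]
  | succ t ih =>
    simp only [trav, dep]
    by_cases h : cfg.pos x0 t = u
    · rw [if_pos h, Nat.count_succ, ih, pos_succ, h]; simp
    · simp [h, ih]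

lemma adj_all (cfg : RotorConfig G) (u : V) (i : ℕ) : G.Adj u (cfg.s u i) := by
  have hp : Function.Periodic (cfg.s u) (cfg.d u) := cfg.periodic u
  rw [← hp.map_mod_nat i]
  exact cfg.adj u _ (Nat.mod_lt _ (cfg.d_pos u))

lemma adj_pos (cfg : RotorConfig G) (x0 : V) (t : ℕ) :
    G.Adj (cfg.pos x0 t) (cfg.pos x0 (t + 1)) := by
  rw [pos_succ]; exact adj_all _ _ _

lemma count_mul_period (p : ℕ → Prop) [DecidablePred p] (d : ℕ) (hp : Function.Periodic p d)
    (q : ℕ) : Nat.count p (q * d) = q * Nat.count p d := by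
  induction q with
  | zero => simp
  | succ q ih =>
    rw [Nat.succ_mul, Nat.count_add, ih, Nat.succ_mul]
    congr 1
    have : (fun k => p (q * d + k)) = p := by
      funext k
      have := hp.nat_mul q k
      rw [add_comm]; simpa using this
    simp only [this]

lemma count_window (cfg : RotorConfig G) (u v : V) (h : G.Adj u v) :
    Nat.count (fun i => cfg.s u (cfg.r0 u + i) = v) (cfg.d u) = cfg.d u / G.degree u := by
  have hp : Function.Periodic (fun i => cfg.s u i = v) (cfg.d u) := by
    intro i; simp [cfg.periodic u i]
  have h1 := Nat.filter_Ico_card_eq_of_periodic (cfg.r0 u) (cfg.d u) _ hp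
  have h2 := Nat.count_eq_card_filter_range (fun i => cfg.s u i = v) (cfg.d u)
  have h3 := cfg.count u v h
  have h4 := Nat.count_add (fun i => cfg.s u i = v) (cfg.r0 u) (cfg.d u)
  have h5 := Nat.count_add (fun i => cfg.s u i = v) (cfg.d u) (cfg.r0 u)
  have h6 : (fun k => cfg.s u (cfg.d u + k) = v) = (fun k => cfg.s u k = v) := by
    funext k; rw [add_comm, cfg.periodic]
  simp only [h6] at h5
  rw [add_comm (cfg.d u)] at h5
  omega

lemma trav_le (cfg : RotorConfig G) (x0 u v w : V) (t : ℕ) (hv : G.Adj u v) (hw : G.Adj u w) :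
    trav cfg x0 u v t ≤ trav cfg x0 u w t + cfg.kappa := by
  have hk : cfg.d u / G.degree u ≤ cfg.kappa :=
    Finset.le_sup (f := fun u => cfg.d u / G.degree u) (Finset.mem_univ u)
  have hp : ∀ v, Function.Periodic (fun i => cfg.s u (cfg.r0 u + i) = v) (cfg.d u) := by
    intro v i; simp [← add_assoc, cfg.periodic]
  rw [trav_eq_count, trav_eq_count]
  set N := dep cfg x0 u t
  have hd := cfg.d_pos u
  have h1 : N ≤ (N / cfg.d u + 1) * cfg.d u := by
    have := Nat.lt_div_mul_add (a := N) hd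
    rw [Nat.succ_mul]; omega
  have h2 : N / cfg.d u * cfg.d u ≤ N := Nat.div_mul_le_self _ _
  have h3 := Nat.count_monotone (fun i => cfg.s u (cfg.r0 u + i) = v) h1
  have h4 := Nat.count_monotone (fun i => cfg.s u (cfg.r0 u + i) = w) h2
  rw [count_mul_period _ _ (hp _), count_window _ _ _ hv, Nat.succ_mul] at h3
  rw [count_mul_period _ _ (hp _), count_window _ _ _ hw] at h4
  omega

lemma trav_sum (cfg : RotorConfig G) (x0 : V) (t : ℕ) :
    ∑ u, ∑ v, trav cfg x0 u v t = t := by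
  induction t with
  | zero => simp [trav]
  | succ t ih =>
    simp only [trav, Finset.sum_add_distrib, ih, ite_and]
    simp

lemma trav_nonadj (cfg : RotorConfig G) (x0 u v : V) (t : ℕ) (h : ¬ G.Adj u v) :
    trav cfg x0 u v t = 0 := by
  induction t with
  | zero => rfl
  | succ t ih =>
    simp only [trav, ih, zero_add, ite_eq_right_iff]
    rintro ⟨rfl, rfl⟩
    exact absurd (adj_pos _ _ _) h

lemma trav_pos (cfg : RotorConfig G) (x0 u v : V) (t : ℕ) (h : trav cfg x0 u v t ≠ 0) :
    ∃ l, 1 ≤ l ∧ l ≤ t ∧ cfg.pos x0 (l - 1) = u ∧ cfg.pos x0 l = v := by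
  induction t with
  | zero => exact absurd rfl h
  | succ t ih =>
    by_cases h0 : trav cfg x0 u v t = 0
    · simp only [trav, h0, zero_add, ne_eq, ite_eq_right_iff, not_forall] at h
      obtain ⟨h, -⟩ := h
      exact ⟨t + 1, by omega, le_rfl, h.1, h.2⟩
    · obtain ⟨l, a, b, c⟩ := ih h0
      exact ⟨l, a, by omega, c⟩

lemma trav_bridge (cfg : RotorConfig G) (x0 p c : V) (S : V → Prop) [DecidablePred S]
    (hp : ¬ S p) (hc : S c)
    (hS : ∀ a b, G.Adj a b → ¬ S a → S b → a = p ∧ b = c) (t : ℕ) :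
    trav cfg x0 p c t + (if S x0 then 1 else 0) =
      trav cfg x0 c p t + if S (cfg.pos x0 t) then 1 else 0 := by
  induction t with
  | zero => rfl
  | succ t ih =>
    simp only [trav]
    have ha := adj_pos cfg x0 t
    generalize cfg.pos x0 t = a at *
    generalize cfg.pos x0 (t + 1) = b at *
    by_cases h1 : S a <;> by_cases h2 : S b
    · have e1 : ¬ (a = p ∧ b = c) := by rintro ⟨rfl, rfl⟩; exact hp h1
      have e2 : ¬ (a = c ∧ b = p) := by rintro ⟨rfl, rfl⟩; exact hp h2
      simp only [e1, e2, h1, h2, if_true, if_false] at *; omega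
    · obtain ⟨rfl, rfl⟩ := hS b a ha.symm h2 h1
      have e1 : ¬ (a = b ∧ b = a) := by rintro ⟨rfl, -⟩; exact hp h1
      simp only [e1, h1, h2, if_true, if_false, and_self] at *; omega
    · obtain ⟨rfl, rfl⟩ := hS a b ha h1 h2
      have e1 : ¬ (a = b ∧ b = a) := by rintro ⟨rfl, -⟩; exact hp h2
      simp only [e1, h1, h2, if_true, if_false, and_self] at *; omega
    · have e1 : ¬ (a = p ∧ b = c) := by rintro ⟨rfl, rfl⟩; exact h2 hc
      have e2 : ¬ (a = c ∧ b = p) := by rintro ⟨rfl, rfl⟩; exact h1 hc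
      simp only [e1, e2, h1, h2, if_false] at *; omega

end general

section tree
variable {k D : ℕ}

/-- `a` is an ancestor (prefix) of `b`. -/
def Pre (a b : KaryTreeVertex k D) : Prop :=
  a.1.val ≤ b.1.val ∧
    ∀ (t : ℕ) (h1 : t < a.1.val) (h2 : t < b.1.val), b.2 ⟨t, h2⟩ = a.2 ⟨t, h1⟩

/-- `a` is the parent of `b`. -/
def Par (a b : KaryTreeVertex k D) : Prop := a.1.val + 1 = b.1.val ∧ Pre a b

lemma adj_iff (a b : KaryTreeVertex k D) : KaryTreeAdj k D a b ↔ Par a b ∨ Par b a := by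
  unfold KaryTreeAdj Par Pre
  constructor
  · rintro (⟨h, h'⟩ | ⟨h, h'⟩)
    · exact Or.inl ⟨h, by omega, h'⟩
    · exact Or.inr ⟨h, by omega, fun t h1 h2 => h' t h2 h1⟩
  · rintro (⟨h, -, h'⟩ | ⟨h, -, h'⟩)
    · exact Or.inl ⟨h, h'⟩
    · exact Or.inr ⟨h, fun t h1 h2 => h' t h2 h1⟩

lemma Pre.refl (a : KaryTreeVertex k D) : Pre a a := ⟨le_rfl, fun _ _ _ => rfl⟩

lemma Pre.trans {a b c : KaryTreeVertex k D} (h : Pre a b) (h' : Pre b c) : Pre a c :=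
  ⟨h.1.trans h'.1, fun t h1 h2 => by
    rw [h'.2 t (lt_of_lt_of_le h1 h.1) h2, h.2 t h1]⟩

lemma Pre.of_common {a b c : KaryTreeVertex k D} (h : Pre a c) (h' : Pre b c)
    (hd : a.1.val ≤ b.1.val) : Pre a b :=
  ⟨hd, fun t h1 h2 => by
    rw [← h'.2 t h2 (lt_of_lt_of_le h2 h'.1), ← h.2 t h1]⟩

lemma Pre.eq {a b : KaryTreeVertex k D} (h : Pre a b) (hd : a.1.val = b.1.val) : a = b := by
  obtain ⟨i, f⟩ := a
  obtain ⟨j, g⟩ := b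
  obtain rfl : i = j := Fin.ext hd
  congr 1
  funext x
  exact (h.2 x.1 x.2 x.2).symm

lemma Par.unique {a b c : KaryTreeVertex k D} (h : Par a c) (h' : Par b c) : a = b := by
  have e : a.1.val = b.1.val := by have := h.1; have := h'.1; omega
  exact (h.2.of_common h'.2 e.le).eq e

lemma exists_par (c : KaryTreeVertex k D) (i : ℕ) (h : c.1.val = i + 1) :
    ∃ a : KaryTreeVertex k D, a.1.val = i ∧ Par a c := by
  have hc := c.1.2
  refine ⟨⟨⟨i, by omega⟩, fun x => c.2 ⟨x.1, by have h2 : x.1 < i := x.2; omega⟩⟩, rfl, ?_⟩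
  exact ⟨h.symm, by simp [h], fun t h1 h2 => rfl⟩

lemma bridge {p c a b : KaryTreeVertex k D} (h : Par p c) (hab : Par a b ∨ Par b a)
    (ha : ¬ Pre c a) (hb : Pre c b) : a = p ∧ b = c := by
  rcases hab with hab | hab
  · by_cases hd : c.1.val ≤ a.1.val
    · exact absurd (hb.of_common hab.2 hd) ha
    · have e : c.1.val = b.1.val := by have := hb.1; have := hab.1; omega
      have := hb.eq e
      subst this
      exact ⟨hab.unique h, rfl⟩
  · exact absurd (hb.trans hab.2) ha

variable {G : SimpleGraph (KaryTreeVertex k D)} [DecidableRel G.Adj]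

lemma trav_par (hG : ∀ a b, G.Adj a b ↔ Par a b ∨ Par b a) (cfg : RotorConfig G)
    (x0 p c : KaryTreeVertex k D) (h : Par p c) (t : ℕ) :
    trav cfg x0 p c t ≤ trav cfg x0 c p t + 1 ∧ trav cfg x0 c p t ≤ trav cfg x0 p c t + 1 := by
  classical
  have hp : ¬ Pre c p := fun h' => by have := h'.1; have := h.1; omega
  have := trav_bridge cfg x0 p c (Pre c) hp (Pre.refl c)
    (fun a b hab => bridge h ((hG a b).1 hab)) t
  split_ifs at this <;> omega

lemma trav_adj (hG : ∀ a b, G.Adj a b ↔ Par a b ∨ Par b a) (cfg : RotorConfig G)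
    (x0 u v : KaryTreeVertex k D) (h : G.Adj u v) (t : ℕ) :
    trav cfg x0 v u t ≤ trav cfg x0 u v t + 1 := by
  rcases (hG _ _).1 h with h | h
  · exact (trav_par hG cfg x0 u v h t).2
  · exact (trav_par hG cfg x0 v u h t).1

lemma move (hG : ∀ a b, G.Adj a b ↔ Par a b ∨ Par b a) (cfg : RotorConfig G)
    (x0 u v : KaryTreeVertex k D) (h : G.Adj u v) (t B : ℕ)
    (hB : ∀ x, trav cfg x0 u x t ≤ B) :
    ∀ x, trav cfg x0 v x t ≤ B + (cfg.kappa + 1) := by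
  intro x
  by_cases hx : G.Adj v x
  · have h1 := trav_le cfg x0 v x u t hx h.symm
    have h2 := trav_adj hG cfg x0 u v h t
    have h3 := hB v
    omega
  · rw [trav_nonadj _ _ _ _ _ hx]; omega

lemma root_move (hG : ∀ a b, G.Adj a b ↔ Par a b ∨ Par b a) (cfg : RotorConfig G)
    (x0 r : KaryTreeVertex k D) (hr : r.1.val = 0) (t i : ℕ) :
    ∀ (u : KaryTreeVertex k D), u.1.val = i → ∀ B,
      ((∀ x, trav cfg x0 u x t ≤ B) → ∀ x, trav cfg x0 r x t ≤ B + i * (cfg.kappa + 1)) ∧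
      ((∀ x, trav cfg x0 r x t ≤ B) → ∀ x, trav cfg x0 u x t ≤ B + i * (cfg.kappa + 1)) := by
  induction i with
  | zero =>
    intro u hu B
    have : u = r := by
      refine Pre.eq ⟨by omega, fun t h1 _ => ?_⟩ (by omega)
      omega
    subst this
    simp
  | succ i ih =>
    intro u hu B
    obtain ⟨a, ha, hau⟩ := exists_par u i hu
    have hadj : G.Adj a u := (hG _ _).2 (Or.inl hau)
    constructor
    · intro h x
      have := (ih a ha _).1 (move hG cfg x0 u a hadj.symm t B h) x
      rw [Nat.succ_mul]; omega
    · intro h x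
      have := move hG cfg x0 a u hadj t _ ((ih a ha B).2 h) x
      rw [Nat.succ_mul]; omega

lemma total (hG : ∀ a b, G.Adj a b ↔ Par a b ∨ Par b a) (cfg : RotorConfig G)
    (x0 : KaryTreeVertex k D) (t B : ℕ) (hB : ∀ u x, trav cfg x0 u x t ≤ B) :
    t ≤ 2 * Fintype.card (KaryTreeVertex k D) * B := by
  classical
  have key : ∀ x : KaryTreeVertex k D, ∑ u, (if Par u x then B else 0) ≤ B := by
    intro x
    by_cases h : ∃ a, Par a x
    · obtain ⟨a, ha⟩ := h
      rw [Finset.sum_eq_single a]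
      · split_ifs <;> omega
      · intro b _ hb
        rw [if_neg]
        exact fun h' => hb (h'.unique ha)
      · simp
    · push Not at h
      simp [h]
  calc t = ∑ u, ∑ v, trav cfg x0 u v t := (trav_sum cfg x0 t).symm
    _ ≤ ∑ u, ∑ v, ((if Par u v then B else 0) + if Par v u then B else 0) := by
        refine Finset.sum_le_sum fun u _ => Finset.sum_le_sum fun v _ => ?_
        by_cases h : G.Adj u v
        · have := hB u v
          rcases (hG _ _).1 h with h | h <;> simp only [h, if_true] <;> omega
        · rw [trav_nonadj _ _ _ _ _ h]; omega
    _ = ∑ x, ∑ u, (if Par u x then B else 0) + ∑ x, ∑ u, (if Par u x then B else 0) := by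
        simp only [Finset.sum_add_distrib]
        rw [Finset.sum_comm]
    _ ≤ ∑ x : KaryTreeVertex k D, B + ∑ x : KaryTreeVertex k D, B :=
        add_le_add (Finset.sum_le_sum fun x _ => key x) (Finset.sum_le_sum fun x _ => key x)
    _ = _ := by simp only [Finset.sum_const, Finset.card_univ, smul_eq_mul]; ring

lemma not_cover (hG : ∀ a b, G.Adj a b ↔ Par a b ∨ Par b a) (cfg : RotorConfig G)
    (x0 : KaryTreeVertex k D) (t : ℕ) (h : ¬ cfg.coversEdges x0 t) :
    t ≤ 2 * Fintype.card (KaryTreeVertex k D) * (cfg.kappa + 2 * D * (cfg.kappa + 1)) := by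
  unfold coversEdges at h
  push Not at h
  obtain ⟨u, v, huv, h⟩ := h
  have h0 : trav cfg x0 u v t = 0 := by
    by_contra h'
    obtain ⟨l, a, b, c, d⟩ := trav_pos _ _ _ _ _ h'
    exact (h l a b).1 c d
  have h1 : ∀ x, trav cfg x0 u x t ≤ cfg.kappa := by
    intro x
    by_cases hx : G.Adj u x
    · have := trav_le cfg x0 u x v t hx huv
      omega
    · rw [trav_nonadj _ _ _ _ _ hx]; omega
  let r : KaryTreeVertex k D := ⟨⟨0, by omega⟩, fun x => x.elim0⟩
  have hD : ∀ w : KaryTreeVertex k D, w.1.val * (cfg.kappa + 1) ≤ D * (cfg.kappa + 1) :=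
    fun w => Nat.mul_le_mul_right _ (by have := w.1.2; omega)
  apply total hG cfg x0
  intro w x
  have h2 := (root_move hG cfg x0 r rfl t _ u rfl _).1 h1
  have h3 := (root_move hG cfg x0 r rfl t _ w rfl _).2 h2 x
  have := hD u
  have := hD w
  rw [mul_assoc 2]
  omega

lemma kappa_pos (cfg : RotorConfig G) (u : KaryTreeVertex k D) : 1 ≤ cfg.kappa := by
  have hk : cfg.d u / G.degree u ≤ cfg.kappa :=
    Finset.le_sup (f := fun u => cfg.d u / G.degree u) (Finset.mem_univ u)
  refine le_trans ?_ hk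
  rw [← cfg.count u (cfg.s u 0) (adj_all _ _ _), Nat.succ_le_iff, Finset.card_pos]
  exact ⟨0, by simp [cfg.d_pos]⟩

lemma pow_le_card : k ^ D ≤ Fintype.card (KaryTreeVertex k D) := by
  have := Fintype.card_le_of_injective
    (fun f : Fin D → Fin k => (⟨Fin.last D, f⟩ : KaryTreeVertex k D))
    (fun a b h => by simpa using h)
  simpa using this

end tree

end RotorAux

/-- For every fixed `k ≥ 2` there is a constant `C_k` such that for every
complete `k`-ary tree on `n` vertices (all leaves at the same depth), the deterministic
edge cover time satisfies `ẼC(G) ≤ C_k·κ̃·n·log n`. -/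
theorem detEdgeCover_karyTree_le (k : ℕ) (hk : 2 ≤ k) :
    ∃ C : ℝ, 0 < C ∧
      ∀ D : ℕ,
        ∀ (G : SimpleGraph (KaryTreeVertex k D)) [DecidableRel G.Adj],
          (∀ a b, G.Adj a b ↔ KaryTreeAdj k D a b) →
          ∀ (cfg : RotorConfig G) (x0 : KaryTreeVertex k D),
            ∃ t : ℕ,
              (t : ℝ) ≤ C * (cfg.kappa : ℝ) * (Fintype.card (KaryTreeVertex k D) : ℝ) *
                Real.logb 2 (Fintype.card (KaryTreeVertex k D) : ℝ) ∧
              cfg.coversEdges x0 t := by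
  open RotorAux in
  refine ⟨11, by norm_num, ?_⟩
  intro D G _ hG' cfg x0
  have hG : ∀ a b, G.Adj a b ↔ Par a b ∨ Par b a := fun a b => (hG' a b).trans (adj_iff a b)
  have hD : 1 ≤ D := by
    by_contra hD
    have h := adj_all cfg x0 0
    generalize cfg.s x0 0 = y at h
    have h1 := x0.1.2
    have h2 := y.1.2
    rcases (hG _ _).1 h with h | h <;> have := h.1 <;> omega
  have hκ := kappa_pos cfg x0
  have hn : 2 ^ D ≤ Fintype.card (KaryTreeVertex k D) :=
    (Nat.pow_le_pow_left hk D).trans pow_le_card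
  set n := Fintype.card (KaryTreeVertex k D) with hn_def
  have hn1 : 1 ≤ n := le_trans Nat.one_le_two_pow hn
  refine ⟨11 * cfg.kappa * n * D, ?_, ?_⟩
  · have hlog : (D : ℝ) ≤ Real.logb 2 (n : ℝ) := by
      rw [Real.le_logb_iff_rpow_le (by norm_num) (by exact_mod_cast hn1)]
      rw [Real.rpow_natCast]
      exact_mod_cast hn
    push_cast
    gcongr
  · by_contra h
    have := not_cover hG cfg x0 _ h
    rw [← hn_def] at this
    have e1 : cfg.kappa ≤ cfg.kappa * D := Nat.le_mul_of_pos_right _ hD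
    have e2 : D ≤ cfg.kappa * D := Nat.le_mul_of_pos_left _ hκ
    have e3 : cfg.kappa + 2 * D * (cfg.kappa + 1) ≤ 5 * (cfg.kappa * D) := by nlinarith
    have e4 := Nat.mul_le_mul_left (2 * n) e3
    have e5 : 1 ≤ n * (cfg.kappa * D) := Nat.mul_pos hn1 (Nat.mul_pos hκ hD)
    nlinarith
end

section
/- There is an absolute constant C such that for every lollipop graph G on n vertices (a complete graph on ⌈n/2⌉ vertices with a path of ⌊n/2⌋ further vertices attached to one of its vertices), the deterministic edge cover time of rotor walks whose rotor sequences are permutations of the neighbors satisfies ẼC(G) ≤ C·n³. -/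
/-- A rotor configuration on `G` whose rotor sequence at each vertex `u` is a permutation of
the neighbors of `u` (encoded as a `(deg u)`-periodic map `s u : ℕ → V` that is injective on
`{0, …, deg u − 1}` with all values neighbors of `u`), together with an initial rotor
position `r0 u`. -/
structure PermRotorConfig {V : Type*} [Fintype V] [DecidableEq V]
    (G : SimpleGraph V) [DecidableRel G.Adj] where
  s : V → ℕ → V
  periodic : ∀ u i, s u (i + G.degree u) = s u i
  adj : ∀ u i, i < G.degree u → G.Adj u (s u i)
  inj : ∀ u i j, i < G.degree u → j < G.degree u → s u i = s u j → i = j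
  r0 : V → ℕ

namespace PermRotorConfig

variable {V : Type*} [Fintype V] [DecidableEq V] {G : SimpleGraph V} [DecidableRel G.Adj]

/-- One step of the rotor walk; a state is a pair (current vertex, rotor positions). -/
def step (cfg : PermRotorConfig G) (st : V × (V → ℕ)) : V × (V → ℕ) :=
  (cfg.s st.1 (st.2 st.1), Function.update st.2 st.1 (st.2 st.1 + 1))

/-- The state of the rotor walk started at `x0` after `t` steps. -/
def state (cfg : PermRotorConfig G) (x0 : V) : ℕ → V × (V → ℕ)
  | 0 => (x0, cfg.r0)
  | t + 1 => cfg.step (state cfg x0 t)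

/-- The position of the rotor walk started at `x0` after `t` steps. -/
def pos (cfg : PermRotorConfig G) (x0 : V) (t : ℕ) : V := (cfg.state x0 t).1

/-- Every vertex of `G` is visited within the first `t` steps of the rotor walk
started at `x0`. -/
def coversVertices (cfg : PermRotorConfig G) (x0 : V) (t : ℕ) : Prop :=
  ∀ v : V, ∃ ℓ, ℓ ≤ t ∧ cfg.pos x0 ℓ = v

/-- Every edge of `G` is traversed (in some direction) within the first `t` steps of the
rotor walk started at `x0`. -/
def coversEdges (cfg : PermRotorConfig G) (x0 : V) (t : ℕ) : Prop :=
  ∀ u v : V, G.Adj u v → ∃ ℓ, 1 ≤ ℓ ∧ ℓ ≤ t ∧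
    ((cfg.pos x0 (ℓ - 1) = u ∧ cfg.pos x0 ℓ = v) ∨
     (cfg.pos x0 (ℓ - 1) = v ∧ cfg.pos x0 ℓ = u))

end PermRotorConfig

/-- Adjacency of the lollipop graph on `n` vertices: vertices `0, …, ⌈n/2⌉−1` form a
clique, and vertices `⌈n/2⌉−1, ⌈n/2⌉, …, n−1` form a path (so the path of the remaining
`⌊n/2⌋` vertices is attached to the clique vertex `⌈n/2⌉−1`). -/
def LollipopAdj (n : ℕ) (i j : Fin n) : Prop :=
  i ≠ j ∧
    ((i.val < (n + 1) / 2 ∧ j.val < (n + 1) / 2) ∨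
     (j.val = i.val + 1 ∧ (n + 1) / 2 ≤ j.val) ∨
     (i.val = j.val + 1 ∧ (n + 1) / 2 ≤ i.val))

namespace PermRotorConfig

variable {V : Type*} [Fintype V] [DecidableEq V] {G : SimpleGraph V} [DecidableRel G.Adj]

/-- Number of departures from `u` during the first `t` steps. -/
def nDep (cfg : PermRotorConfig G) (x0 : V) (t : ℕ) (u : V) : ℕ :=
  Nat.count (fun l => cfg.pos x0 l = u) t

/-- Number of traversals of the arc `(u, v)` during the first `t` steps. -/
def nArc (cfg : PermRotorConfig G) (x0 : V) (t : ℕ) (u v : V) : ℕ :=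
  Nat.count (fun i => cfg.s u (cfg.r0 u + i) = v) (cfg.nDep x0 t u)

lemma nDep_succ (cfg : PermRotorConfig G) (x0 : V) (t : ℕ) (u : V) :
    cfg.nDep x0 (t + 1) u = cfg.nDep x0 t u + if cfg.pos x0 t = u then 1 else 0 := by
  simp only [nDep, Nat.count_succ]

lemma state_snd (cfg : PermRotorConfig G) (x0 : V) (t : ℕ) (u : V) :
    (cfg.state x0 t).2 u = cfg.r0 u + cfg.nDep x0 t u := by
  induction t with
  | zero => simp [state, nDep]
  | succ t ih =>
    rw [nDep_succ]
    simp only [state, step, pos]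
    by_cases h : (cfg.state x0 t).1 = u
    · subst h
      simp [ih, add_assoc]
    · rw [Function.update_of_ne (Ne.symm h), ih]
      simp [h]

lemma pos_succ (cfg : PermRotorConfig G) (x0 : V) (t : ℕ) :
    cfg.pos x0 (t + 1) =
      cfg.s (cfg.pos x0 t) (cfg.r0 (cfg.pos x0 t) + cfg.nDep x0 t (cfg.pos x0 t)) := by
  rw [← state_snd]
  rfl

lemma nArc_succ (cfg : PermRotorConfig G) (x0 : V) (t : ℕ) (u v : V) :
    cfg.nArc x0 (t + 1) u v = cfg.nArc x0 t u v +
      if cfg.pos x0 t = u ∧ cfg.pos x0 (t + 1) = v then 1 else 0 := by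
  unfold nArc
  rw [nDep_succ]
  by_cases h : cfg.pos x0 t = u
  · subst h
    simp only [if_true, Nat.count_succ, true_and]
    rw [pos_succ]
  · simp [h]

lemma exists_of_nArc_pos (cfg : PermRotorConfig G) (x0 : V) (t : ℕ) (u v : V)
    (h : 1 ≤ cfg.nArc x0 t u v) :
    ∃ l, 1 ≤ l ∧ l ≤ t ∧ cfg.pos x0 (l - 1) = u ∧ cfg.pos x0 l = v := by
  induction t with
  | zero => simp [nArc, nDep] at h
  | succ t ih =>
    by_cases h' : cfg.pos x0 t = u ∧ cfg.pos x0 (t + 1) = v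
    · exact ⟨t + 1, by omega, le_rfl, by simpa using h'.1, h'.2⟩
    · rw [nArc_succ, if_neg h', add_zero] at h
      obtain ⟨l, h1, h2, h3⟩ := ih h
      exact ⟨l, h1, by omega, h3⟩

lemma sum_out (cfg : PermRotorConfig G) (x0 : V) (t : ℕ) (u : V) :
    ∑ v, cfg.nArc x0 t u v = cfg.nDep x0 t u := by
  induction t with
  | zero => simp [nArc, nDep]
  | succ t ih =>
    simp only [nArc_succ, nDep_succ, Finset.sum_add_distrib, ih]
    by_cases h : cfg.pos x0 t = u <;> simp [h]

lemma sum_in (cfg : PermRotorConfig G) (x0 : V) (t : ℕ) (v : V) :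
    ∑ u, cfg.nArc x0 t u v + (if x0 = v then 1 else 0) =
      cfg.nDep x0 t v + if cfg.pos x0 t = v then 1 else 0 := by
  induction t with
  | zero =>
    have h0 : cfg.pos x0 0 = x0 := rfl
    simp [nArc, nDep, h0]
  | succ t ih =>
    simp only [nArc_succ, nDep_succ, Finset.sum_add_distrib]
    rw [← ih]
    by_cases h : cfg.pos x0 (t + 1) = v
    · simp [h]; omega
    · simp [h]

lemma sum_nDep (cfg : PermRotorConfig G) (x0 : V) (t : ℕ) :
    ∑ u, cfg.nDep x0 t u = t := by
  induction t with
  | zero => simp [nDep]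
  | succ t ih => simp [nDep_succ, Finset.sum_add_distrib, ih]

lemma s_mod (cfg : PermRotorConfig G) (u : V) (i : ℕ) :
    cfg.s u i = cfg.s u (i % G.degree u) := by
  have h : Function.Periodic (cfg.s u) (G.degree u) := cfg.periodic u
  exact (h.map_mod_nat i).symm

lemma adj_all (cfg : PermRotorConfig G) (u : V) (hd : 0 < G.degree u) (i : ℕ) :
    G.Adj u (cfg.s u i) := by
  rw [s_mod]
  exact cfg.adj u _ (Nat.mod_lt _ hd)

lemma nArc_eq_zero (cfg : PermRotorConfig G) (x0 : V) (t : ℕ) (u v : V)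
    (hd : 0 < G.degree u) (h : ¬ G.Adj u v) : cfg.nArc x0 t u v = 0 := by
  unfold nArc
  have : (fun i => cfg.s u (cfg.r0 u + i) = v) = fun _ => False := by
    funext i
    apply eq_false
    rintro rfl
    exact h (cfg.adj_all u hd _)
  simp [this]

lemma exists_idx (cfg : PermRotorConfig G) (u v : V) (h : G.Adj u v) :
    ∃ i < G.degree u, cfg.s u i = v := by
  have himg : (Finset.range (G.degree u)).image (cfg.s u) = G.neighborFinset u := by
    apply Finset.eq_of_subset_of_card_le
    · intro w hw
      simp only [Finset.mem_image, Finset.mem_range] at hw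
      obtain ⟨i, hi, rfl⟩ := hw
      simpa using cfg.adj u i hi
    · rw [Finset.card_image_of_injOn]
      · simp
      · intro i hi j hj hij
        exact cfg.inj u i j (by simpa using hi) (by simpa using hj) hij
  have hv : v ∈ G.neighborFinset u := by simpa using h
  rw [← himg] at hv
  simpa using hv

lemma nArc_formula (cfg : PermRotorConfig G) (x0 : V) (t : ℕ) (u v : V) (h : G.Adj u v) :
    ∃ c, cfg.nArc x0 t u v = cfg.nDep x0 t u / G.degree u +
      if c < cfg.nDep x0 t u % G.degree u then 1 else 0 := by
  have hd : 0 < G.degree u := (G.degree_pos_iff_exists_adj u).2 ⟨v, h⟩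
  obtain ⟨i, hi, hiv⟩ := cfg.exists_idx u v h
  -- shift index
  obtain ⟨j, hj⟩ : ∃ j, cfg.r0 u + j ≡ i [MOD G.degree u] := by
    refine ⟨cfg.r0 u * (G.degree u - 1) + i, ?_⟩
    have e : cfg.r0 u + (cfg.r0 u * (G.degree u - 1) + i) = i + G.degree u * cfg.r0 u := by
      obtain ⟨d, hd'⟩ : ∃ d, G.degree u = d + 1 := ⟨G.degree u - 1, by omega⟩
      rw [hd', Nat.add_sub_cancel]; ring
    rw [e]
    simp [Nat.ModEq]
  have hp : (fun l => cfg.s u (cfg.r0 u + l) = v) = fun l => l ≡ j [MOD G.degree u] := by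
    funext l
    apply propext
    rw [s_mod]
    constructor
    · intro hl
      have h1 := cfg.inj u _ i (Nat.mod_lt _ hd) hi (hl.trans hiv.symm)
      have h2 : cfg.r0 u + l ≡ i [MOD G.degree u] := by
        rw [Nat.ModEq, h1, Nat.mod_eq_of_lt hi]
      exact Nat.ModEq.add_left_cancel' _ (h2.trans hj.symm)
    · intro hl
      have h2 : cfg.r0 u + l ≡ i [MOD G.degree u] := (hl.add_left _).trans hj
      rw [Nat.ModEq, Nat.mod_eq_of_lt hi] at h2
      rw [h2, hiv]
  refine ⟨j % G.degree u, ?_⟩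
  unfold nArc
  rw [← Nat.count_modEq_card _ hd]
  simp only [Nat.count_eq_card_filter_range]
  congr 1
  apply Finset.filter_congr
  intro l _
  exact iff_of_eq (congrFun hp l)

lemma nArc_le (cfg : PermRotorConfig G) (x0 : V) (t : ℕ) (u v : V) (h : G.Adj u v) (k : ℕ)
    (hk : cfg.nDep x0 t u ≤ k * G.degree u) : cfg.nArc x0 t u v ≤ k := by
  have hd : 0 < G.degree u := (G.degree_pos_iff_exists_adj u).2 ⟨v, h⟩
  obtain ⟨c, hc⟩ := cfg.nArc_formula x0 t u v h
  rw [hc]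
  rcases hk.lt_or_eq with hk | hk
  · have := (Nat.div_lt_iff_lt_mul hd).2 hk
    split_ifs <;> omega
  · rw [hk]; simp [Nat.mul_div_cancel _ hd]

lemma le_nArc (cfg : PermRotorConfig G) (x0 : V) (t : ℕ) (u v : V) (h : G.Adj u v) (k : ℕ)
    (hk : k * G.degree u ≤ cfg.nDep x0 t u) : k ≤ cfg.nArc x0 t u v := by
  have hd : 0 < G.degree u := (G.degree_pos_iff_exists_adj u).2 ⟨v, h⟩
  obtain ⟨c, hc⟩ := cfg.nArc_formula x0 t u v h
  rw [hc]
  have := (Nat.le_div_iff_mul_le hd).2 hk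
  omega

lemma exists_phase_end (cfg : PermRotorConfig G) (x0 : V) (hdeg : ∀ u, 0 < G.degree u) (k : ℕ) :
    ∃ t, t ≤ k * ∑ u, G.degree u ∧ cfg.pos x0 t = x0 ∧
      cfg.nDep x0 t x0 = k * G.degree x0 := by
  have hex : ∃ t, ∃ u, k * G.degree u < cfg.nDep x0 t u := by
    refine ⟨k * ∑ u, G.degree u + 1, ?_⟩
    by_contra! hcon
    have := Finset.sum_le_sum (s := Finset.univ) (fun u _ => hcon u)
    rw [sum_nDep, ← Finset.mul_sum] at this
    omega
  classical
  obtain ⟨u, hu⟩ := Nat.find_spec hex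
  have hmin := fun m (hm : m < Nat.find hex) => Nat.find_min hex hm
  set T := Nat.find hex
  obtain ⟨t, ht⟩ : ∃ t, T = t + 1 := by
    refine Nat.exists_eq_succ_of_ne_zero ?_
    intro h0
    rw [h0] at hu
    simp [nDep] at hu
  have hle : ∀ w, cfg.nDep x0 t w ≤ k * G.degree w := by
    intro w
    have := hmin t (by omega)
    push Not at this
    exact this w
  rw [ht, nDep_succ] at hu
  have hpu : cfg.pos x0 t = u := by
    by_contra hne
    rw [if_neg hne] at hu
    have := hle u
    omega
  rw [if_pos hpu] at hu
  have hNu : cfg.nDep x0 t u = k * G.degree u := by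
    have := hle u
    omega
  have hux : x0 = u := by
    by_contra hne
    have hin := cfg.sum_in x0 t u
    rw [if_neg hne, if_pos hpu, hNu] at hin
    have h1 : ∑ w, cfg.nArc x0 t w u ≤ ∑ w, if G.Adj u w then k else 0 := by
      apply Finset.sum_le_sum
      intro w _
      split_ifs with hw
      · exact cfg.nArc_le x0 t w u hw.symm k (hle w)
      · rw [cfg.nArc_eq_zero x0 t w u (hdeg w) (fun h => hw h.symm)]
    rw [← Finset.sum_filter, Finset.sum_const, ← G.neighborFinset_eq_filter,
      G.card_neighborFinset_eq_degree, smul_eq_mul, mul_comm] at h1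
    omega
  subst hux
  refine ⟨t, ?_, hpu, hNu⟩
  have := Finset.sum_le_sum (s := Finset.univ) (fun u _ => hle u)
  rwa [sum_nDep, ← Finset.mul_sum] at this

lemma level_step (cfg : PermRotorConfig G) (x0 : V) (hdeg : ∀ u, 0 < G.degree u) (t : ℕ)
    (ht : cfg.pos x0 t = x0) (v w : V) (h : G.Adj v w) (j : ℕ)
    (hv : (j + 1) * G.degree v ≤ cfg.nDep x0 t v) : j * G.degree w ≤ cfg.nDep x0 t w := by
  classical
  by_contra! hw
  set S : Finset V := Finset.univ.filter (fun u => (j + 1) * G.degree u ≤ cfg.nDep x0 t u) with hS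
  have hvS : v ∈ S := by simp [hS, hv]
  have hwS : w ∈ Sᶜ := by
    simp only [hS, Finset.mem_compl, Finset.mem_filter, Finset.mem_univ, true_and, not_le]
    nlinarith
  have hbal : ∀ u, ∑ x, cfg.nArc x0 t x u = ∑ x, cfg.nArc x0 t u x := by
    intro u
    have := cfg.sum_in x0 t u
    rw [ht] at this
    rw [sum_out]
    omega
  have hsum : ∑ u ∈ S, ∑ x ∈ Sᶜ, cfg.nArc x0 t x u = ∑ u ∈ S, ∑ x ∈ Sᶜ, cfg.nArc x0 t u x := by
    have h1 : ∑ u ∈ S, ∑ x, cfg.nArc x0 t x u = ∑ u ∈ S, ∑ x, cfg.nArc x0 t u x :=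
      Finset.sum_congr rfl (fun u _ => hbal u)
    simp only [← Finset.sum_add_sum_compl S, Finset.sum_add_distrib] at h1
    rw [Finset.sum_comm (s := S) (t := S)] at h1
    omega
  have hterm : ∀ u ∈ S, ∀ x ∈ Sᶜ, cfg.nArc x0 t x u ≤ cfg.nArc x0 t u x := by
    intro u hu x hx
    simp only [hS, Finset.mem_compl, Finset.mem_filter, Finset.mem_univ, true_and, not_le] at hu hx
    by_cases hux : G.Adj u x
    · exact (cfg.nArc_le x0 t x u hux.symm (j + 1) hx.le).trans
        (cfg.le_nArc x0 t u x hux (j + 1) hu)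
    · rw [cfg.nArc_eq_zero x0 t x u (hdeg x) (fun h => hux h.symm)]
      exact Nat.zero_le _
  have hlt : ∑ u ∈ S, ∑ x ∈ Sᶜ, cfg.nArc x0 t x u < ∑ u ∈ S, ∑ x ∈ Sᶜ, cfg.nArc x0 t u x := by
    apply Finset.sum_lt_sum
    · exact fun u hu => Finset.sum_le_sum (hterm u hu)
    · refine ⟨v, hvS, Finset.sum_lt_sum (hterm v hvS) ⟨w, hwS, ?_⟩⟩
      have h1 := cfg.nArc_le x0 t w v h.symm j hw.le
      have h2 := cfg.le_nArc x0 t v w h (j + 1) hv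
      omega
  omega

end PermRotorConfig

/-- There is an absolute constant `C` such that for every lollipop graph
on `n` vertices, the deterministic edge cover time of rotor walks whose rotor sequences
are permutations of the neighbors satisfies `ẼC(G) ≤ C·n³`. -/
theorem detEdgeCover_lollipop_le :
    ∃ C : ℝ, 0 < C ∧
      ∀ n : ℕ,
        ∀ (G : SimpleGraph (Fin n)) [DecidableRel G.Adj],
          (∀ i j, G.Adj i j ↔ LollipopAdj n i j) →
          ∀ (cfg : PermRotorConfig G) (x0 : Fin n),
            ∃ t : ℕ, (t : ℝ) ≤ C * (n : ℝ) ^ 3 ∧ cfg.coversEdges x0 t := by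
  refine ⟨1, one_pos, ?_⟩
  intro n G _ hG cfg x0
  rcases Nat.lt_or_ge n 2 with hn | hn
  · refine ⟨0, by simp, ?_⟩
    intro u v huv
    exact absurd (Fin.ext (by omega)) huv.ne
  have hcons : ∀ (i : ℕ) (hi : i + 1 < n), G.Adj ⟨i, by omega⟩ ⟨i + 1, hi⟩ := by
    intro i hi
    rw [hG]
    refine ⟨by simp [Fin.ext_iff], ?_⟩
    by_cases h : i + 1 < (n + 1) / 2
    · exact Or.inl ⟨Nat.lt_of_succ_lt h, h⟩
    · exact Or.inr (Or.inl ⟨rfl, not_lt.mp h⟩)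
  have hdeg : ∀ u, 0 < G.degree u := by
    intro u
    rw [G.degree_pos_iff_exists_adj]
    obtain ⟨i, hi⟩ := u
    by_cases h : i + 1 < n
    · exact ⟨_, hcons i h⟩
    · obtain ⟨k, rfl⟩ : ∃ k, i = k + 1 := ⟨i - 1, by omega⟩
      exact ⟨_, (hcons k hi).symm⟩
  obtain ⟨t, htle, htx, htN⟩ := cfg.exists_phase_end x0 hdeg n
  refine ⟨t, ?_, ?_⟩
  · have h1 : ∑ u, G.degree u ≤ n * n := by
      have := Finset.sum_le_card_nsmul Finset.univ (fun u => G.degree u) n (by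
        intro u _
        have := G.degree_lt_card_verts u
        simp at this
        omega)
      simpa using this
    have h2 : t ≤ n ^ 3 := by
      calc t ≤ n * ∑ u, G.degree u := htle
        _ ≤ n * (n * n) := Nat.mul_le_mul_left _ h1
        _ = n ^ 3 := by ring
    rw [one_mul]
    exact_mod_cast h2
  · have hmono : ∀ (d : ℕ) (v : Fin n), (v.val = x0.val + d ∨ x0.val = v.val + d) →
        (n - d) * G.degree v ≤ cfg.nDep x0 t v := by
      intro d
      induction d with
      | zero =>
        intro v hv
        obtain rfl : v = x0 := Fin.ext (by omega)
        simp [htN]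
      | succ d ih =>
        intro v hv
        have hvn := v.2
        have hxn := x0.2
        have e : n - d = (n - (d + 1)) + 1 := by omega
        rcases hv with hv | hv
        · have hw := ih ⟨x0.val + d, by omega⟩ (Or.inl rfl)
          rw [e] at hw
          refine cfg.level_step x0 hdeg t htx _ v ?_ _ hw
          have := hcons (x0.val + d) (by omega)
          convert this using 1
          exact Fin.ext (by simp; omega)
        · have hw := ih ⟨v.val + 1, by omega⟩ (Or.inr (by simp; omega))
          rw [e] at hw
          exact cfg.level_step x0 hdeg t htx _ v (hcons v.val (by omega)).symm _ hw
    intro u v huv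
    have hu := u.2
    have hx := x0.2
    have h1 : 1 * G.degree u ≤ cfg.nDep x0 t u := by
      rcases le_total x0.val u.val with h | h
      · refine le_trans (Nat.mul_le_mul_right _ ?_) (hmono (u.val - x0.val) u (Or.inl (by omega)))
        omega
      · refine le_trans (Nat.mul_le_mul_right _ ?_) (hmono (x0.val - u.val) u (Or.inr (by omega)))
        omega
    obtain ⟨l, hl1, hl2, hl3⟩ := cfg.exists_of_nArc_pos x0 t u v (cfg.le_nArc x0 t u v huv 1 h1)
    exact ⟨l, hl1, hl2, Or.inl hl3⟩
end

section
/- For every finite connected simple graph G with m edges and minimum degree δ, there exist a rotor configuration whose rotor sequences are permutations of the neighbors and a starting vertex such that the rotor walk needs at least m − δ steps to visit every vertex of G; in particular, the deterministic vertex cover time satisfies ṼC(G) ≥ m − δ. -/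
open SimpleGraph in
theorem rotor_euler {V : Type*} [Fintype V] (H : SimpleGraph V) (v : V) :
    ∃ p : H.Walk v v, p.darts.Nodup ∧ ∀ d : H.Dart, H.Reachable v d.fst → d ∈ p.darts := by
  classical
  by_contra hcon
  push Not at hcon
  have key : ∀ n : ℕ, ∃ p : H.Walk v v, p.darts.Nodup ∧ (∀ d ∈ p.darts, d.symm ∈ p.darts) ∧
      n ≤ p.darts.length := by
    intro n
    induction n with
    | zero => exact ⟨Walk.nil, by simp, by simp, by simp⟩
    | succ n ih =>
      obtain ⟨p, hnd, hsym, hlen⟩ := ih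
      have hex : ∃ d : H.Dart, d.fst ∈ p.support ∧ d ∉ p.darts := by
        by_contra hno
        push Not at hno
        obtain ⟨d, hr, hd⟩ := hcon p hnd
        refine hd (hno d ?_)
        have aux : ∀ (a b : V) (q : H.Walk a b), a ∈ p.support → b ∈ p.support := by
          intro a b q
          induction q with
          | nil => exact id
          | cons h q ih =>
            intro ha
            exact ih (p.dart_snd_mem_support_of_mem_darts (hno ⟨(_, _), h⟩ ha))
        obtain ⟨q⟩ := hr
        exact aux _ _ q p.start_mem_support
      obtain ⟨d, hfs, hd⟩ := hex
      have hds : d.symm ∉ p.darts := fun h => hd (by simpa using hsym _ h)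
      let p' : H.Walk v v := (p.takeUntil d.fst hfs).append
        (Walk.cons d.adj (Walk.cons d.adj.symm (p.dropUntil d.fst hfs)))
      have hperm : p'.darts.Perm (d :: d.symm :: p.darts) := by
        have h1 : p.darts = (p.takeUntil d.fst hfs).darts ++ (p.dropUntil d.fst hfs).darts := by
          rw [← Walk.darts_append, Walk.take_spec]
        rw [h1]
        simp only [p', Walk.darts_append, Walk.darts_cons]
        exact (List.perm_middle).trans ((List.perm_middle).cons _)
      refine ⟨p', ?_, ?_, ?_⟩
      · rw [hperm.nodup_iff]
        simp only [List.nodup_cons, List.mem_cons, not_or]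
        exact ⟨⟨d.symm_ne.symm, hd⟩, hds, hnd⟩
      · intro e he
        rw [hperm.mem_iff] at he ⊢
        simp only [List.mem_cons] at he ⊢
        rcases he with rfl | rfl | he
        · simp
        · simp
        · exact Or.inr (Or.inr (hsym _ he))
      · rw [hperm.length_eq]
        simp only [List.length_cons]
        omega
  obtain ⟨p, hnd, -, hlen⟩ := key (Fintype.card H.Dart + 1)
  have := hnd.length_le_card
  omega

theorem rotor_realize {V : Type*} [Fintype V] [DecidableEq V]
    (G : SimpleGraph V) [DecidableRel G.Adj] (f : ℕ → V) (L : ℕ)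
    (hadj : ∀ i < L, G.Adj (f i) (f (i + 1)))
    (hinj : ∀ i < L, ∀ j < L, f i = f j → f (i + 1) = f (j + 1) → i = j) :
    ∃ cfg : PermRotorConfig G, ∀ t ≤ L, cfg.pos (f 0) t = f t := by
  classical
  let l : V → List V := fun u => ((List.range L).filter (fun i => f i = u)).map (fun i => f (i + 1))
  let m : V → List V := fun u => l u ++ (G.neighborFinset u \ (l u).toFinset).toList
  have hl : ∀ u, ∀ x ∈ l u, G.Adj u x := by
    intro u x hx
    simp only [l, List.mem_map, List.mem_filter, List.mem_range, decide_eq_true_eq] at hx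
    obtain ⟨i, ⟨hi, rfl⟩, rfl⟩ := hx
    exact hadj i hi
  have hlnd : ∀ u, (l u).Nodup := by
    intro u
    refine List.Nodup.map_on ?_ (List.nodup_range.filter _)
    intro i hi j hj h
    simp only [List.mem_filter, List.mem_range, decide_eq_true_eq] at hi hj
    exact hinj i hi.1 j hj.1 (hi.2.trans hj.2.symm) h
  have hmnd : ∀ u, (m u).Nodup := by
    intro u
    refine List.Nodup.append (hlnd u) (Finset.nodup_toList _) ?_
    intro x hx hx'
    simp at hx'
    exact hx'.2 hx
  have hmem : ∀ u x, x ∈ m u ↔ G.Adj u x := by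
    intro u x
    simp only [m, List.mem_append, Finset.mem_toList, Finset.mem_sdiff,
      SimpleGraph.mem_neighborFinset, List.mem_toFinset]
    have := hl u x
    tauto
  have hlen : ∀ u, (m u).length = G.degree u := by
    intro u
    rw [← List.toFinset_card_of_nodup (hmnd u), ← SimpleGraph.card_neighborFinset_eq_degree]
    congr 1
    ext x
    simp [hmem]
  let cfg : PermRotorConfig G :=
    { s := fun u i => (m u).getD (i % G.degree u) u
      periodic := by intro u i; simp
      adj := by
        intro u i hi
        rw [Nat.mod_eq_of_lt hi, List.getD_eq_getElem _ _ (by rw [hlen]; exact hi), ← hmem]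
        exact List.getElem_mem _
      inj := by
        intro u i j hi hj h
        rw [Nat.mod_eq_of_lt hi, Nat.mod_eq_of_lt hj,
          List.getD_eq_getElem _ _ (by rw [hlen]; exact hi),
          List.getD_eq_getElem _ _ (by rw [hlen]; exact hj)] at h
        exact (hmnd u).getElem_inj_iff.1 h
      r0 := fun _ => 0 }
  refine ⟨cfg, ?_⟩
  have hstate : ∀ t ≤ L, cfg.state (f 0) t =
      (f t, fun u => ((List.range t).filter (fun i => f i = u)).length) := by
    intro t
    induction t with
    | zero => intro _; simp [PermRotorConfig.state, cfg]
    | succ t ih =>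
      intro ht
      have hs : cfg.s (f t) ((List.range t).filter (fun i => f i = f t)).length = f (t + 1) := by
        have hsplit : ∃ r, l (f t) =
            ((List.range t).filter (fun i => f i = f t)).map (fun i => f (i + 1)) ++
              f (t + 1) :: r := by
          obtain ⟨k, rfl⟩ : ∃ k, L = t + 1 + k := ⟨L - (t + 1), by omega⟩
          simp only [l]
          rw [List.range_add, List.range_succ]
          simp only [List.filter_append, List.map_append]
          simp
        obtain ⟨r, hr⟩ := hsplit
        have hlt : ((List.range t).filter (fun i => f i = f t)).length < (m (f t)).length := by
          simp only [m, hr, List.length_append, List.length_map, List.length_cons]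
          omega
        change (m (f t)).getD (_ % _) _ = _
        rw [Nat.mod_eq_of_lt (by rw [← hlen]; exact hlt), List.getD_eq_getElem _ _ hlt]
        simp only [m, hr]
        simp
      rw [PermRotorConfig.state, ih (by omega), PermRotorConfig.step]
      simp only [hs]
      congr 1
      funext u
      rw [List.range_succ, List.filter_append]
      by_cases h : u = f t
      · subst h; simp
      · rw [Function.update_of_ne h]
        simp [Ne.symm h]
  intro t ht
  rw [PermRotorConfig.pos, hstate t ht]

theorem rotor_walk {V : Type*} [Fintype V] [DecidableEq V]
    (G H : SimpleGraph V) [DecidableRel G.Adj] (hle : H ≤ G) {v : V} (p : H.Walk v v)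
    (hnd : p.darts.Nodup) (w : V) (hw : w ∉ p.support) :
    ∃ (cfg : PermRotorConfig G) (x0 : V), ∀ t : ℕ, cfg.coversVertices x0 t → p.darts.length ≤ t := by
  have hL := p.length_darts
  obtain ⟨cfg, h⟩ := rotor_realize G p.getVert p.length
    (fun i hi => hle (p.adj_getVert_succ hi)) (by
      intro i hi j hj h1 h2
      have := @List.Nodup.getElem_inj_iff _ _ hnd i (by omega) j (by omega)
      rw [← this]
      rw [p.darts_getElem_eq_getVert, p.darts_getElem_eq_getVert]
      ext <;> simp [h1, h2])
  refine ⟨cfg, p.getVert 0, ?_⟩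
  intro t ht
  by_contra hlt
  obtain ⟨k, hk, hk'⟩ := ht w
  rw [h k (by omega)] at hk'
  exact hw (hk' ▸ p.getVert_mem_support k)

open SimpleGraph in
theorem detVertexCover_ge_edges_sub_minDegree
    {V : Type*} [Fintype V] [DecidableEq V]
    (G : SimpleGraph V) [DecidableRel G.Adj] (hconn : G.Connected) :
    ∃ (cfg : PermRotorConfig G) (x0 : V),
      ∀ t : ℕ, cfg.coversVertices x0 t →
        (G.edgeFinset.card : ℝ) - (G.minDegree : ℝ) ≤ (t : ℝ) := by
  classical
  suffices hN : ∃ (cfg : PermRotorConfig G) (x0 : V),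
      ∀ t : ℕ, cfg.coversVertices x0 t → G.edgeFinset.card ≤ t + G.minDegree by
    obtain ⟨cfg, x0, h⟩ := hN
    refine ⟨cfg, x0, fun t ht => ?_⟩
    have := h t ht
    rw [sub_le_iff_le_add]
    exact_mod_cast this
  haveI := hconn.nonempty
  obtain ⟨u, hu⟩ := G.exists_minimal_degree_vertex
  by_cases hc : ∃ c, c ≠ u
  swap
  · push Not at hc
    obtain ⟨cfg, -⟩ := rotor_realize G (fun _ => u) 0 (by simp) (by simp)
    refine ⟨cfg, u, fun t _ => ?_⟩
    have : G.edgeFinset = ∅ := by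
      rw [edgeFinset_eq_empty]
      ext a b
      rw [hc a, hc b]
      simp
    simp [this]
  obtain ⟨c, hc⟩ := hc
  let H₁ : SimpleGraph V :=
    { Adj := fun a b => G.Adj a b ∧ a ≠ u ∧ b ≠ u
      symm := ⟨fun a b h => ⟨h.1.symm, h.2.2, h.2.1⟩⟩
      loopless := ⟨fun a h => G.loopless.irrefl a h.1⟩ }
  let H₂ : SimpleGraph V :=
    { Adj := fun a b => G.Adj a b ∧ ¬ H₁.Reachable c a ∧ ¬ H₁.Reachable c b
      symm := ⟨fun a b h => ⟨h.1.symm, h.2.2, h.2.1⟩⟩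
      loopless := ⟨fun a h => G.loopless.irrefl a h.1⟩ }
  have hle₁ : H₁ ≤ G := fun a b h => h.1
  have hle₂ : H₂ ≤ G := fun a b h => h.1
  have huC : ¬ H₁.Reachable c u := by
    rintro ⟨q⟩
    have aux : ∀ (a b : V) (q : H₁.Walk a b), a ≠ u → b ≠ u := by
      intro a b q
      induction q with
      | nil => exact id
      | cons h q ih => exact fun _ => ih h.2.2
    exact aux _ _ q hc rfl
  have hr₂ : ∀ a, ¬ H₁.Reachable c a → H₂.Reachable u a := by
    intro a ha
    have aux : ∀ (a b : V) (q : G.Walk a b), b = u → ¬ H₁.Reachable c a → H₂.Reachable a b := by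
      intro a b q
      induction q with
      | nil => exact fun _ _ => Reachable.refl _
      | @cons a w b h q ih =>
        intro hb ha
        by_cases hau : a = u
        · rw [hau, hb]
        have hw : ¬ H₁.Reachable c w := by
          intro hw
          have hwu : w ≠ u := by rintro rfl; exact huC hw
          have : H₁.Adj w a := ⟨h.symm, hwu, hau⟩
          exact ha (hw.trans this.reachable)
        have : H₂.Adj a w := ⟨h, ha, hw⟩
        exact this.reachable.trans (ih hb hw)
    obtain ⟨q⟩ := hconn.preconnected a u
    exact (aux _ _ q rfl ha).symm
  obtain ⟨p₁, hn₁, hf₁⟩ := rotor_euler H₁ c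
  obtain ⟨p₂, hn₂, hf₂⟩ := rotor_euler H₂ u
  have hu₁ : u ∉ p₁.support := fun h => huC ⟨p₁.takeUntil u h⟩
  have hc₂ : c ∉ p₂.support := by
    intro h
    have aux : ∀ (a b : V) (q : H₂.Walk a b), ¬ H₁.Reachable c a → ¬ H₁.Reachable c b := by
      intro a b q
      induction q with
      | nil => exact id
      | cons h q ih => exact fun _ => ih h.2.2
    exact aux _ _ (p₂.takeUntil c h) huC (Reachable.refl _)
  have hcount : 2 * G.edgeFinset.card ≤
      p₁.darts.length + p₂.darts.length + (G.minDegree + G.minDegree) := by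
    rw [← G.dart_card_eq_twice_card_edges, ← Finset.card_univ,
      ← Finset.card_image_of_injective _ (Dart.toProd_injective (G := G))]
    have hsub : (Finset.univ.image (fun d : G.Dart => d.toProd)) ⊆
        ((p₁.darts.map (fun d => d.toProd)).toFinset ∪ (p₂.darts.map (fun d => d.toProd)).toFinset)
        ∪ ((G.neighborFinset u).image (fun x => (u, x)) ∪
          (G.neighborFinset u).image (fun x => (x, u))) := by
      intro e he
      simp only [Finset.mem_image, Finset.mem_univ, true_and] at he
      obtain ⟨⟨⟨a, b⟩, hab⟩, rfl⟩ := he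
      have hab : G.Adj a b := hab
      simp only [Finset.mem_union, List.mem_toFinset, List.mem_map, Finset.mem_image,
        mem_neighborFinset]
      by_cases hau : a = u
      · subst hau; exact Or.inr (Or.inl ⟨b, hab, rfl⟩)
      by_cases hbu : b = u
      · subst hbu; exact Or.inr (Or.inr ⟨a, hab.symm, rfl⟩)
      have h1 : H₁.Adj a b := ⟨hab, hau, hbu⟩
      left
      by_cases hr : H₁.Reachable c a
      · exact Or.inl ⟨⟨(a, b), h1⟩, hf₁ _ hr, rfl⟩
      · have h2 : H₂.Adj a b := ⟨hab, hr, fun h => hr (h.trans h1.symm.reachable)⟩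
        exact Or.inr ⟨⟨(a, b), h2⟩, hf₂ _ (hr₂ a hr), rfl⟩
    refine (Finset.card_le_card hsub).trans ?_
    refine (Finset.card_union_le _ _).trans (add_le_add ?_ ?_)
    · refine (Finset.card_union_le _ _).trans (add_le_add ?_ ?_)
      · exact (List.toFinset_card_le _).trans (by simp)
      · exact (List.toFinset_card_le _).trans (by simp)
    · rw [hu, ← card_neighborFinset_eq_degree]
      exact (Finset.card_union_le _ _).trans
        (add_le_add Finset.card_image_le Finset.card_image_le)
  rcases le_total p₁.darts.length p₂.darts.length with h | h
  · obtain ⟨cfg, x0, H⟩ := rotor_walk G H₂ hle₂ p₂ hn₂ c hc₂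
    exact ⟨cfg, x0, fun t ht => by have := H t ht; omega⟩
  · obtain ⟨cfg, x0, H⟩ := rotor_walk G H₁ hle₁ p₁ hn₁ u hu₁
    exact ⟨cfg, x0, fun t ht => by have := H t ht; omega⟩
end

section
/- For every fixed integer k ≥ 2 there is a constant c_k > 0 such that for every complete k-ary tree G on n vertices (all leaves at the same depth log_k n − 1), there exist a rotor configuration whose rotor sequences are permutations of the neighbors and a starting vertex (the root) such that the rotor walk needs at least c_k·n·log n steps to visit every vertex; in particular ṼC(G) ≥ c_k·n·log n. -/
namespace KaryCover

open Finset

/-- Number of traversals of the arc `u → w` during the first `t` steps. -/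
def flow {V : Type*} [DecidableEq V] (x : ℕ → V) (t : ℕ) (u w : V) : ℕ :=
  ∑ l ∈ range t, if x l = u ∧ x (l + 1) = w then 1 else 0

theorem flow_succ {V : Type*} [DecidableEq V] (x : ℕ → V) (t : ℕ) (u w : V) :
    flow x (t + 1) u w = flow x t u w + if x t = u ∧ x (t + 1) = w then 1 else 0 := by
  unfold flow
  rw [sum_range_succ]

open Classical in
/-- Flow through a cut consisting of a single edge. -/
theorem cut {V : Type*} [DecidableEq V] (adj : V → V → Prop) (hsymm : ∀ a b, adj a b → adj b a)
    (S : V → Prop) (p v : V)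
    (hp : ¬ S p) (hv : S v) (hS : ∀ a b, adj a b → ¬ S a → S b → a = p ∧ b = v)
    (x : ℕ → V) (hx : ∀ n, adj (x n) (x (n + 1))) (h0 : ¬ S (x 0)) (t : ℕ) :
    flow x t p v = flow x t v p + if S (x t) then 1 else 0 := by
  induction t with
  | zero => simp [flow, h0]
  | succ t ih =>
    rw [flow_succ, flow_succ, ih]
    have ha := hx t
    have h1 := hS _ _ ha
    have h2 := hS _ _ (hsymm _ _ ha)
    generalize x t = a at *
    generalize x (t + 1) = b at *
    by_cases hSa : S a <;> by_cases hSb : S b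
    · have : ¬ (a = p ∧ b = v) := by rintro ⟨rfl, rfl⟩; exact hp hSa
      have : ¬ (a = v ∧ b = p) := by rintro ⟨rfl, rfl⟩; exact hp hSb
      simp [*]
    · obtain ⟨rfl, rfl⟩ := h2 hSb hSa
      have : ¬ (a = b ∧ b = a) := by rintro ⟨rfl, -⟩; exact hSb hSa
      simp [*]
    · obtain ⟨rfl, rfl⟩ := h1 hSa hSb
      have : ¬ (b = a ∧ a = b) := by rintro ⟨rfl, -⟩; exact hSa hSb
      rw [if_neg hSa, if_pos hSb, if_pos ⟨rfl, rfl⟩, if_neg (fun h => this h.symm)]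
    · have : ¬ (a = p ∧ b = v) := by rintro ⟨rfl, rfl⟩; exact hSb hv
      have : ¬ (a = v ∧ b = p) := by rintro ⟨rfl, rfl⟩; exact hSa hv
      simp [*]

theorem count_mod (d i N : ℕ) (hi : i < d) :
    #{m ∈ range N | m % d = d - 1} ≤ #{m ∈ range N | m % d = i} := by
  apply card_le_card_of_injOn (fun m => m - (d - 1 - i))
  · intro m hm
    simp only [coe_filter, mem_range, Set.mem_ofPred_eq] at hm ⊢
    refine ⟨by omega, ?_⟩
    have h1 := Nat.div_add_mod m d
    rw [hm.2] at h1
    have : m - (d - 1 - i) = i + d * (m / d) := by omega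
    rw [this, Nat.add_mul_mod_self_left, Nat.mod_eq_of_lt hi]
  · intro m hm m' hm' h
    simp only [coe_filter, mem_range, Set.mem_ofPred_eq] at hm hm' h
    have := Nat.mod_le m d
    have := Nat.mod_le m' d
    omega

theorem exists_list {V : Type*} [DecidableEq V] (A : Finset V) (w : V) (hw : w ∈ A) :
    ∃ l : List V, l.Nodup ∧ l.length = #A ∧ (∀ a, a ∈ l ↔ a ∈ A) ∧ l[#A - 1]? = some w := by
  have hc := card_erase_add_one hw
  refine ⟨(A.erase w).toList ++ [w], ?_, ?_, ?_, ?_⟩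
  · simp [List.nodup_append, nodup_toList]
    intro a ha _ ; exact ha
  · simp only [List.length_append, length_toList, List.length_singleton]; exact hc
  · intro a
    simp only [List.mem_append, mem_toList, mem_erase, List.mem_singleton]
    constructor
    · rintro (h | rfl)
      · exact h.2
      · exact hw
    · intro h
      by_cases a = w <;> simp [*]
  · rw [← hc]
    simp

theorem exists_cfg {V : Type*} [Fintype V] [DecidableEq V] (G : SimpleGraph V)
    [DecidableRel G.Adj] (L : V → V) (hL : ∀ u, G.Adj u (L u)) :
    ∃ cfg : PermRotorConfig G, ∀ x0,
      (∀ n, G.Adj (cfg.pos x0 n) (cfg.pos x0 (n + 1))) ∧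
      ∀ t u w, G.Adj u w → flow (cfg.pos x0) t u (L u) ≤ flow (cfg.pos x0) t u w := by
  have H := fun u => exists_list (G.neighborFinset u) (L u) (by simpa using hL u)
  simp only [SimpleGraph.card_neighborFinset_eq_degree, SimpleGraph.mem_neighborFinset] at H
  choose l hnd hlen hmem hlast using H
  have hdpos : ∀ u, 0 < G.degree u := fun u => by
    rw [← hlen u]; exact List.length_pos_of_mem ((hmem u _).2 (hL u))
  have hlt : ∀ u i, i % G.degree u < (l u).length := fun u i => by
    rw [hlen u]; exact Nat.mod_lt _ (hdpos u)
  let cfg : PermRotorConfig G :=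
    { s := fun u i => (l u)[i % G.degree u]'(hlt u i)
      periodic := by intro u i; simp
      adj := by intro u i _; exact (hmem u _).1 (List.getElem_mem _)
      inj := by
        intro u i j hi hj h
        have := (List.Nodup.getElem_inj_iff (hnd u)).1 h
        rwa [Nat.mod_eq_of_lt hi, Nat.mod_eq_of_lt hj] at this
      r0 := fun _ => 0 }
  have hs : ∀ u i, cfg.s u i = (l u)[i % G.degree u]'(hlt u i) := fun _ _ => rfl
  have hr0 : ∀ u, cfg.r0 u = 0 := fun _ => rfl
  refine ⟨cfg, fun x0 => ⟨?_, ?_⟩⟩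
  · intro n
    have : cfg.pos x0 (n + 1) = cfg.s (cfg.pos x0 n) ((cfg.state x0 n).2 (cfg.pos x0 n)) := rfl
    rw [this, hs]
    exact (hmem _ _).1 (List.getElem_mem _)
  · have key : ∀ t u w, flow (cfg.pos x0) t u w
        = #{m ∈ range ((cfg.state x0 t).2 u) | cfg.s u m = w} := by
      intro t u w
      induction t with
      | zero => simp [flow, PermRotorConfig.state, hr0]
      | succ t ih =>
        rw [flow_succ, ih]
        have h1 : cfg.pos x0 (t + 1)
          = cfg.s (cfg.pos x0 t) ((cfg.state x0 t).2 (cfg.pos x0 t)) := rfl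
        have h2 : (cfg.state x0 (t + 1)).2 = Function.update (cfg.state x0 t).2 (cfg.pos x0 t)
          ((cfg.state x0 t).2 (cfg.pos x0 t) + 1) := rfl
        rw [h1, h2]
        by_cases hu : cfg.pos x0 t = u
        · subst hu
          rw [Function.update_self, range_add_one, filter_insert]
          by_cases hw : cfg.s (cfg.pos x0 t) ((cfg.state x0 t).2 (cfg.pos x0 t)) = w
          · simp [hw]
          · simp [hw]
        · rw [Function.update_of_ne (Ne.symm hu)]
          simp [hu]
    intro t u w hw
    rw [key, key]
    obtain ⟨i, hi, rfl⟩ := List.getElem_of_mem ((hmem u w).2 hw)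
    rw [hlen] at hi
    have hchar : ∀ j (hj : j < (l u).length) m, cfg.s u m = (l u)[j] ↔ m % G.degree u = j := by
      intro j hj m
      rw [hs, List.Nodup.getElem_inj_iff (hnd u)]
    obtain ⟨hj, hj'⟩ := List.getElem?_eq_some_iff.1 (hlast u)
    rw [← hj']
    simp only [hchar]
    exact count_mod _ _ _ hi

/-- The prefix of length `i` of an infinite word. -/
def pre {k D : ℕ} (f : ℕ → Fin k) (i : ℕ) : KaryTreeVertex k D :=
  ⟨⟨min i D, by omega⟩, fun t => f t⟩

theorem vext {k D : ℕ} (a b : KaryTreeVertex k D) (h : a.1.val = b.1.val)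
    (hval : ∀ t (h1 : t < a.1.val) (h2 : t < b.1.val), a.2 ⟨t, h1⟩ = b.2 ⟨t, h2⟩) : a = b := by
  obtain ⟨⟨i, hi⟩, a⟩ := a
  obtain ⟨⟨j, hj⟩, b⟩ := b
  simp only at h
  subst h
  congr 1
  funext t
  exact hval t t.2 t.2

/-- Extension of the word of a vertex by zeros. -/
def ext {k D : ℕ} [NeZero k] (a : KaryTreeVertex k D) (t : ℕ) : Fin k :=
  if h : t < a.1.val then a.2 ⟨t, h⟩ else 0

theorem pre_ext {k D : ℕ} [NeZero k] (a : KaryTreeVertex k D) : pre (ext a) a.1.val = a := by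
  have := a.1.2
  apply vext
  · simp [pre]; omega
  · intro t h1 h2
    simp [pre, ext, h2]

theorem pre_adj {k D : ℕ} (f : ℕ → Fin k) (i : ℕ) (hi : i < D) :
    KaryTreeAdj k D (pre f i) (pre f (i + 1)) := by
  left
  refine ⟨by simp [pre]; omega, ?_⟩
  intro t h1 h2
  rfl

theorem adj_symm {k D : ℕ} (a b : KaryTreeVertex k D) (h : KaryTreeAdj k D a b) :
    KaryTreeAdj k D b a := by
  rcases h with h | h
  · right; exact ⟨h.1, fun t h1 h2 => h.2 t h2 h1⟩
  · left; exact ⟨h.1, fun t h1 h2 => h.2 t h2 h1⟩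

/-- The subtree of `pre f j`. -/
def Sub {k D : ℕ} (f : ℕ → Fin k) (j : ℕ) (a : KaryTreeVertex k D) : Prop :=
  j ≤ a.1.val ∧ ∀ t (h : t < a.1.val), t < j → a.2 ⟨t, h⟩ = f t

theorem sub_cut {k D : ℕ} (f : ℕ → Fin k) (i : ℕ) (hi : i < D) (a b : KaryTreeVertex k D)
    (h : KaryTreeAdj k D a b) (ha : ¬ Sub f (i + 1) a) (hb : Sub f (i + 1) b) :
    a = pre f i ∧ b = pre f (i + 1) := by
  have hbD := b.1.2
  rcases h with ⟨h1, h2⟩ | ⟨h1, h2⟩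
  · have hai : a.1.val = i := by
      by_contra hne
      have := hb.1
      apply ha
      refine ⟨by omega, fun t ht hti => ?_⟩
      rw [← h2 t ht (by omega)]
      exact hb.2 t _ hti
    constructor
    · apply vext
      · simp [pre]; omega
      · intro t h3 h4
        rw [← h2 t h3 (by omega), hb.2 t _ (by omega)]
        rfl
    · apply vext
      · simp [pre]; omega
      · intro t h3 h4
        rw [hb.2 t _ (by omega)]
        rfl
  · exfalso
    have := hb.1
    apply ha
    refine ⟨by omega, fun t ht hti => ?_⟩
    rw [h2 t ht (by omega)]
    exact hb.2 t _ hti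

open Classical in
/-- The last direction of each rotor. -/
noncomputable def last {k D : ℕ} [NeZero k] (a : KaryTreeVertex k D) : KaryTreeVertex k D :=
  if (∀ t, ext a t = 0) ∧ a.1.val < D then pre (ext a) (a.1.val + 1) else pre (ext a) (a.1.val - 1)

theorem last_adj {k D : ℕ} [NeZero k] (hD : 1 ≤ D) (a : KaryTreeVertex k D) :
    KaryTreeAdj k D a (last a) := by
  unfold last
  have haD := a.1.2
  split_ifs with h
  · have := pre_adj (ext a) a.1.val h.2
    rwa [pre_ext] at this
  · have hpos : 1 ≤ a.1.val := by
      by_contra h0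
      apply h
      refine ⟨fun t => ?_, by omega⟩
      unfold ext
      rw [dif_neg (by omega)]
    have := pre_adj (D := D) (ext a) (a.1.val - 1) (by omega)
    rw [Nat.sub_add_cancel hpos, pre_ext] at this
    exact adj_symm _ _ this

theorem last_zero {k D : ℕ} [NeZero k] (i : ℕ) (hi : i < D) :
    last (pre (fun _ => 0) i : KaryTreeVertex k D) = pre (fun _ => 0) (i + 1) := by
  have h0 : ext (pre (fun _ => 0) i : KaryTreeVertex k D) = fun _ => 0 := by
    funext t; unfold ext; split
    · rfl
    · rfl
  unfold last
  rw [h0, if_pos]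
  · apply vext
    · simp [pre]; omega
    · intro t h1 h2; rfl
  · refine ⟨fun _ => rfl, ?_⟩
    simp [pre]; omega

theorem last_nonzero {k D : ℕ} [NeZero k] (f : ℕ → Fin k) (hf : f 0 ≠ 0) (i : ℕ)
    (hi : i + 1 ≤ D) :
    last (pre f (i + 1) : KaryTreeVertex k D) = pre f i := by
  have h0 : ¬ ∀ t, ext (pre f (i + 1) : KaryTreeVertex k D) t = 0 := by
    intro h
    have := h 0
    unfold ext at this
    rw [dif_pos (by simp [pre]; omega)] at this
    exact hf this
  unfold last
  rw [if_neg (fun h => h0 h.1)]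
  apply vext
  · simp [pre]; omega
  · intro t h1 h2
    simp [pre] at h1 h2
    simp only [pre, ext]
    rw [dif_pos (by omega)]

theorem main_flow {k D : ℕ} [NeZero k] (x : ℕ → KaryTreeVertex k D)
    (hx : ∀ n, KaryTreeAdj k D (x n) (x (n + 1)))
    (h0 : x 0 = pre (fun _ => 0) 0) (t : ℕ) (ht : x t = pre (fun _ => 0) D)
    (hmono : ∀ u w, KaryTreeAdj k D u w → flow x t u (last u) ≤ flow x t u w)
    (f : ℕ → Fin k) (hf : f 0 ≠ 0) (i : ℕ) (hi : i < D) :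
    D ≤ flow x t (pre f i) (pre f (i + 1)) := by
  classical
  have hcut : ∀ (g : ℕ → Fin k) i, i < D → flow x t (pre g i) (pre g (i + 1)) =
      flow x t (pre g (i + 1)) (pre g i) + if Sub g (i + 1) (x t) then 1 else 0 := by
    intro g i hi
    apply cut (KaryTreeAdj k D) adj_symm (Sub g (i + 1)) _ _ _ _ (sub_cut g i hi) x hx
    · rw [h0]; intro h; have := h.1; simp [pre] at this
    · intro h; have := h.1; simp [pre] at this
    · refine ⟨by simp [pre]; omega, fun t _ _ => rfl⟩
  have hz : ∀ j, j < D →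
      j + 1 ≤ flow x t (pre (fun _ => 0) (D - 1 - j)) (pre (fun _ => 0) (D - 1 - j + 1)) := by
    intro j
    induction j with
    | zero =>
      intro hj
      rw [hcut _ _ (by omega), ht, if_pos]
      · omega
      · refine ⟨by simp [pre]; omega, fun t _ _ => rfl⟩
    | succ j ih =>
      intro hj
      have h1 := ih (by omega)
      rw [hcut _ _ (by omega), ht, if_pos]
      · have e : D - 1 - (j + 1) + 1 = D - 1 - j := by omega
        rw [e]
        have h2 := hmono (pre (fun _ => 0) (D - 1 - j)) (pre (fun _ => 0) (D - 1 - (j + 1))) (by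
          apply adj_symm
          rw [← e]
          exact pre_adj _ _ (by omega))
        rw [last_zero _ (by omega)] at h2
        omega
      · refine ⟨by simp [pre]; omega, fun t _ _ => rfl⟩
  induction i with
  | zero =>
    have h1 := hz (D - 1) (by omega)
    rw [Nat.sub_self] at h1
    have e : (pre (fun _ => 0) 0 : KaryTreeVertex k D) = pre f 0 := by
      apply vext
      · rfl
      · intro t h1; simp [pre] at h1
    have h2 := hmono (pre f 0) (pre f 1) (pre_adj _ _ hi)
    rw [← e, last_zero 0 hi] at h2
    rw [← e]
    simp only [zero_add] at h1 h2 ⊢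
    omega
  | succ i ih =>
    have h1 := ih (by omega)
    have h2 := hmono (pre f (i + 1)) (pre f (i + 1 + 1)) (pre_adj _ _ hi)
    rw [last_nonzero f hf i (by omega)] at h2
    rw [hcut _ _ (by omega), ht, if_neg] at h1
    · omega
    · intro h
      have := h.2 0 (by simp [pre]; omega) (by omega)
      exact hf this.symm

theorem sum_flow {V : Type*} [DecidableEq V] (x : ℕ → V) (t M : ℕ) (A : Finset V)
    (h : ∀ u ∈ A, ∃ p, M ≤ flow x t p u) : #A * M ≤ t := by
  calc #A * M = ∑ u ∈ A, M := by simp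
    _ ≤ ∑ u ∈ A, ∑ l ∈ range t, (if x (l + 1) = u then 1 else 0) := by
      apply sum_le_sum
      intro u hu
      obtain ⟨p, hp⟩ := h u hu
      refine hp.trans ?_
      apply sum_le_sum
      intro l _
      split_ifs <;> simp_all
    _ = ∑ l ∈ range t, ∑ u ∈ A, (if x (l + 1) = u then 1 else 0) := sum_comm
    _ ≤ ∑ l ∈ range t, 1 := by
      apply sum_le_sum
      intro l _
      rw [sum_ite_eq]
      split_ifs <;> simp
    _ = t := by simp

theorem card_le (k D : ℕ) (hk : 2 ≤ k) : Fintype.card (KaryTreeVertex k D) ≤ 2 * k ^ D := by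
  rw [Fintype.card_sigma]
  simp only [Fintype.card_fun, Fintype.card_fin]
  rw [Fin.sum_univ_eq_sum_range (fun i => k ^ i) (D + 1)]
  induction D with
  | zero => simp
  | succ D ih =>
    rw [sum_range_succ, pow_succ]
    have := Nat.mul_le_mul_left (k ^ D) hk
    omega

theorem time_ge {k D : ℕ} [NeZero k] (hk : 2 ≤ k) (x : ℕ → KaryTreeVertex k (D + 1))
    (hx : ∀ n, KaryTreeAdj k (D + 1) (x n) (x (n + 1)))
    (h0 : x 0 = pre (fun _ => 0) 0) (t : ℕ) (ht : x t = pre (fun _ => 0) (D + 1))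
    (hmono : ∀ u w, KaryTreeAdj k (D + 1) u w → flow x t u (last u) ≤ flow x t u w) :
    k ^ D * (D + 1) ≤ t := by
  classical
  let F : (Fin D → Fin k) → ℕ → Fin k := fun g t =>
    if t = 0 then ⟨1, hk⟩ else if h : t - 1 < D then g ⟨t - 1, h⟩ else 0
  let A : Finset (KaryTreeVertex k (D + 1)) := univ.image (fun g => pre (F g) (D + 1))
  have hA : #A = k ^ D := by
    rw [card_image_of_injective]
    · simp
    · intro g g' h
      funext j
      have e : ∀ g : Fin D → Fin k,
          ext (pre (F g) (D + 1) : KaryTreeVertex k (D + 1)) (j + 1) = g j := by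
        intro g
        simp [ext, pre, F]
      rw [← e g, ← e g']
      exact congrArg (fun a => ext a (j + 1)) h
  rw [← hA]
  apply sum_flow x
  intro u hu
  obtain ⟨g, -, rfl⟩ := mem_image.1 hu
  refine ⟨pre (F g) D, main_flow x hx h0 t ht hmono (F g) ?_ D (by omega)⟩
  intro h
  have := congrArg Fin.val h
  simp [F] at this

end KaryCover

/-- For every fixed `k ≥ 2` there is a constant `c_k > 0` such that for
every sufficiently deep complete `k`-ary tree on `n` vertices, there is a rotor
configuration (with permutation rotor sequences) such that the rotor walk started at the
root needs at least `c_k·n·log n` steps to visit every vertex; in particular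
`ṼC(G) ≥ c_k·n·log n`. -/
theorem detVertexCover_karyTree_ge (k : ℕ) (hk : 2 ≤ k) :
    ∃ c : ℝ, 0 < c ∧ ∃ D0 : ℕ,
      ∀ D : ℕ, D0 ≤ D →
        ∀ (G : SimpleGraph (KaryTreeVertex k D)) [DecidableRel G.Adj],
          (∀ a b, G.Adj a b ↔ KaryTreeAdj k D a b) →
          ∃ cfg : PermRotorConfig G,
            ∀ t : ℕ,
              cfg.coversVertices ⟨⟨0, Nat.succ_pos D⟩, fun i => i.elim0⟩ t →
              c * (Fintype.card (KaryTreeVertex k D) : ℝ) *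
                  Real.logb 2 (Fintype.card (KaryTreeVertex k D) : ℝ) ≤ (t : ℝ) := by
  have : NeZero k := ⟨by omega⟩
  have hk1 : (1 : ℝ) < k := by exact_mod_cast hk
  have hl : 0 < Real.logb 2 k := Real.logb_pos (by norm_num) hk1
  refine ⟨1 / (2 * k * (Real.logb 2 k + 1)), by positivity, 1, ?_⟩
  rintro D hD G _ hG
  obtain ⟨D, rfl⟩ : ∃ E, D = E + 1 := ⟨D - 1, by omega⟩
  obtain ⟨cfg, hcfg⟩ := KaryCover.exists_cfg G KaryCover.last
    (fun u => (hG _ _).2 (KaryCover.last_adj hD u))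
  refine ⟨cfg, fun t ht => ?_⟩
  obtain ⟨s, hst, hs⟩ := ht (KaryCover.pre (fun _ => 0) (D + 1))
  obtain ⟨h1, h2⟩ := hcfg ⟨⟨0, Nat.succ_pos (D + 1)⟩, fun i => i.elim0⟩
  have key : k ^ D * (D + 1) ≤ s := by
    refine KaryCover.time_ge hk _ (fun n => (hG _ _).1 (h1 n)) ?_ s hs
      (fun u w h => h2 s u w ((hG _ _).2 h))
    apply KaryCover.vext
    · simp [KaryCover.pre, PermRotorConfig.pos, PermRotorConfig.state]
    · intro t h1
      simp [PermRotorConfig.pos, PermRotorConfig.state] at h1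
  have key' : (k : ℝ) ^ D * (D + 1) ≤ t := by exact_mod_cast key.trans hst
  have hn : (Fintype.card (KaryTreeVertex k (D + 1)) : ℝ) ≤ 2 * (k : ℝ) ^ (D + 1) := by
    exact_mod_cast KaryCover.card_le k (D + 1) hk
  have hn1 : (1 : ℝ) ≤ (Fintype.card (KaryTreeVertex k (D + 1)) : ℝ) := by
    exact_mod_cast Fintype.card_pos_iff.2 ⟨KaryCover.pre (fun _ => 0) 0⟩
  generalize (Fintype.card (KaryTreeVertex k (D + 1)) : ℝ) = n at hn hn1
  have hlog : Real.logb 2 n ≤ (D + 1) * (Real.logb 2 k + 1) := by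
    calc Real.logb 2 n ≤ Real.logb 2 (2 * (k : ℝ) ^ (D + 1)) :=
          Real.logb_le_logb_of_le (by norm_num) (by linarith) hn
      _ = 1 + (D + 1) * Real.logb 2 k := by
          rw [Real.logb_mul (by norm_num) (by positivity), Real.logb_pow,
            Real.logb_self_eq_one (by norm_num)]
          push_cast; ring
      _ ≤ _ := by
          have : (0 : ℝ) ≤ D := Nat.cast_nonneg D
          linarith
  have hlog0 : 0 ≤ Real.logb 2 n := Real.logb_nonneg (by norm_num) hn1
  refine le_trans ?_ key'
  calc 1 / (2 * k * (Real.logb 2 k + 1)) * n * Real.logb 2 n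
      ≤ 1 / (2 * k * (Real.logb 2 k + 1)) * (2 * (k : ℝ) ^ (D + 1))
          * ((D + 1) * (Real.logb 2 k + 1)) := by gcongr
    _ = (k : ℝ) ^ D * (D + 1) := by
        have : (k : ℝ) ≠ 0 := by positivity
        have : Real.logb 2 k + 1 ≠ 0 := by positivity
        rw [pow_succ]
        field_simp
end

section
/- Let n be an even positive integer and let G be the cycle on n+1 vertices. There exist a rotor configuration (each rotor sequence being a permutation of the two neighbors) and a starting vertex such that the rotor walk needs (n²+n)/2 steps to visit every vertex of G; in particular, the deterministic vertex cover time satisfies ṼC(G) ≥ (n²+n)/2. -/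
namespace RotorCycle

lemma cast_inj (n : ℕ) (h k l : ℤ) (hn : (n : ℤ) = 2 * h) (hk : -h ≤ k ∧ k ≤ h)
    (hl : -h ≤ l ∧ l ≤ h) (e : (k : ZMod (n + 1)) = (l : ZMod (n + 1))) : k = l := by
  rw [ZMod.intCast_eq_intCast_iff_dvd_sub] at e
  have := Int.eq_zero_of_abs_lt_dvd e (by push_cast; rw [abs_lt]; omega)
  omega

/-- Right-moving phase: visited interval `[-a, a]`, walker at `x`. -/
def InvR (n : ℕ) (h : ℤ) (t : ℤ) (st : ZMod (n + 1) × (ZMod (n + 1) → ℕ)) (a x : ℤ) : Prop :=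
  0 ≤ a ∧ a < h ∧ -a ≤ x ∧ x ≤ a ∧ t = a * (2 * a + 1) + x + a ∧ st.1 = (x : ZMod (n + 1)) ∧
    ∀ k : ℤ, -h ≤ k → k ≤ h → (Even (st.2 (k : ZMod (n + 1))) ↔ (k < -a ∨ (x ≤ k ∧ k ≤ a)))

/-- Left-moving phase: visited interval `[-a, a+1]`, walker at `x`. -/
def InvL (n : ℕ) (h : ℤ) (t : ℤ) (st : ZMod (n + 1) × (ZMod (n + 1) → ℕ)) (a x : ℤ) : Prop :=
  0 ≤ a ∧ a < h ∧ -a ≤ x ∧ x ≤ a + 1 ∧ t = (2 * a + 1) * (a + 1) + (a + 1 - x) ∧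
    st.1 = (x : ZMod (n + 1)) ∧
    ∀ k : ℤ, -h ≤ k → k ≤ h → (Even (st.2 (k : ZMod (n + 1))) ↔ (k < -a ∨ (x < k ∧ k ≤ a + 1)))

lemma update_even (n : ℕ) (h x k : ℤ) (hn : (n : ℤ) = 2 * h) (hx : -h ≤ x ∧ x ≤ h)
    (hk : -h ≤ k ∧ k ≤ h) (r : ZMod (n + 1) → ℕ) :
    Even (Function.update r (x : ZMod (n + 1)) (r x + 1) (k : ZMod (n + 1))) ↔
      ((k = x ∧ ¬ Even (r k)) ∨ (k ≠ x ∧ Even (r k))) := by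
  by_cases e : k = x
  · subst e
    simp [Nat.even_add_one]
  · have : (k : ZMod (n + 1)) ≠ (x : ZMod (n + 1)) := fun q => e (cast_inj n h k x hn hk hx q)
    simp [Function.update_of_ne this, e]

lemma inv_step (n : ℕ) (h : ℤ) (hn : (n : ℤ) = 2 * h) (t : ℤ)
    (st st' : ZMod (n + 1) × (ZMod (n + 1) → ℕ))
    (ht : t + 1 < h * (2 * h + 1))
    (h1 : st'.1 = if Even (st.2 st.1) then st.1 + 1 else st.1 - 1)
    (h2 : st'.2 = Function.update st.2 st.1 (st.2 st.1 + 1))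
    (hi : ∃ a x, InvR n h t st a x ∨ InvL n h t st a x) :
    ∃ a x, InvR n h (t + 1) st' a x ∨ InvL n h (t + 1) st' a x := by
  obtain ⟨a, x, hi | hi⟩ := hi
  · obtain ⟨ha, hah, hx1, hx2, htt, hp, hr⟩ := hi
    have hev : Even (st.2 (x : ZMod (n + 1))) := (hr x (by omega) (by omega)).2 (by omega)
    rw [hp, if_pos hev] at h1
    rw [hp] at h2
    have hup := fun k (q1 : -h ≤ k) (q2 : k ≤ h) =>
      update_even n h x k hn (by omega) ⟨q1, q2⟩ st.2
    by_cases e : x = a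
    · refine ⟨a, x + 1, Or.inr ⟨ha, hah, by omega, by omega, ?_, by rw [h1]; push_cast; rfl, ?_⟩⟩
      · rw [htt, e]; ring
      · intro k q1 q2
        rw [h2, hup k q1 q2, hr k q1 q2]
        omega
    · refine ⟨a, x + 1, Or.inl ⟨ha, hah, by omega, by omega, ?_, by rw [h1]; push_cast; rfl, ?_⟩⟩
      · rw [htt]; ring
      · intro k q1 q2
        rw [h2, hup k q1 q2, hr k q1 q2]
        omega
  · obtain ⟨ha, hah, hx1, hx2, htt, hp, hr⟩ := hi
    have hev : ¬ Even (st.2 (x : ZMod (n + 1))) := by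
      rw [hr x (by omega) (by omega)]; omega
    rw [hp, if_neg hev] at h1
    rw [hp] at h2
    have hup := fun k (q1 : -h ≤ k) (q2 : k ≤ h) =>
      update_even n h x k hn (by omega) ⟨q1, q2⟩ st.2
    by_cases e : x = -a
    · have hlt : a + 1 < h := by
        by_contra hc
        have : h = a + 1 := by omega
        rw [this, htt, e] at ht
        nlinarith
      refine ⟨a + 1, x - 1, Or.inl ⟨by omega, hlt, by omega, by omega, ?_,
        by rw [h1]; push_cast; rfl, ?_⟩⟩
      · rw [htt, e]; ring
      · intro k q1 q2
        rw [h2, hup k q1 q2, hr k q1 q2]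
        omega
    · refine ⟨a, x - 1, Or.inr ⟨ha, hah, by omega, by omega, ?_, by rw [h1]; push_cast; rfl, ?_⟩⟩
      · rw [htt]; ring
      · intro k q1 q2
        rw [h2, hup k q1 q2, hr k q1 q2]
        omega

end RotorCycle

open RotorCycle in
theorem detVertexCover_cycle_ge (n : ℕ) (hpos : 0 < n) (heven : Even n)
    (G : SimpleGraph (ZMod (n + 1))) [DecidableRel G.Adj]
    (hadj : ∀ i j : ZMod (n + 1), G.Adj i j ↔ (j = i + 1 ∨ i = j + 1)) :
    ∃ (cfg : PermRotorConfig G) (x0 : ZMod (n + 1)),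
      ∀ t : ℕ, cfg.coversVertices x0 t →
        ((n : ℝ) ^ 2 + (n : ℝ)) / 2 ≤ (t : ℝ) := by
  classical
  obtain ⟨m, hm⟩ := heven
  obtain ⟨h, hh⟩ : ∃ h : ℤ, h = m := ⟨_, rfl⟩
  have hn : (n : ℤ) = 2 * h := by omega
  have hh0 : 0 < h := by omega
  have hne : ∀ u : ZMod (n + 1), u + 1 ≠ u - 1 := by
    intro u hu
    have h1 : (1 : ZMod (n + 1)) = -1 := by linear_combination hu
    have := cast_inj n h 1 (-1) hn (by omega) (by omega) (by push_cast; exact h1)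
    omega
  have hdeg : ∀ u, G.degree u = 2 := by
    intro u
    have : G.neighborFinset u = {u + 1, u - 1} := by
      ext v
      simp only [SimpleGraph.mem_neighborFinset, hadj, Finset.mem_insert, Finset.mem_singleton]
      rw [eq_sub_iff_add_eq, eq_comm (a := u)]
    rw [← SimpleGraph.card_neighborFinset_eq_degree, this, Finset.card_pair (hne u)]
  let cfg : PermRotorConfig G :=
    { s := fun u i => if Even i then u + 1 else u - 1
      periodic := by
        intro u i
        rw [hdeg]
        simp [Nat.even_add]
      adj := by
        intro u i _
        rw [hadj]
        split_ifs
        · left; rfl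
        · right; ring
      inj := by
        intro u i j hi hj hs
        rw [hdeg] at hi hj
        have := hne u
        have := (hne u).symm
        interval_cases i <;> interval_cases j <;> simp_all
      r0 := fun u => if ∃ k : ℤ, 1 ≤ k ∧ k ≤ h ∧ (k : ZMod (n + 1)) = u then 1 else 0 }
  refine ⟨cfg, 0, ?_⟩
  have hinv : ∀ t : ℕ, (t : ℤ) < h * (2 * h + 1) →
      ∃ a x, InvR n h t (cfg.state 0 t) a x ∨ InvL n h t (cfg.state 0 t) a x := by
    intro t
    induction t with
    | zero =>
      intro _
      refine ⟨0, 0, Or.inl ⟨le_rfl, hh0, by simp, le_rfl, by simp, ?_, ?_⟩⟩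
      · simp [PermRotorConfig.state]
      · intro k q1 q2
        change Even (if ∃ l : ℤ, 1 ≤ l ∧ l ≤ h ∧ (l : ZMod (n + 1)) = k then 1 else 0) ↔ _
        split_ifs with hc
        · obtain ⟨l, l1, l2, l3⟩ := hc
          have := cast_inj n h l k hn (by omega) (by omega) l3
          simp only [Nat.not_even_one, false_iff]
          omega
        · have : ¬ (1 ≤ k) := fun q => hc ⟨k, q, q2, rfl⟩
          simp only [Even.zero, true_iff]
          omega
    | succ t ih =>
      intro ht
      push_cast at ht ⊢
      exact inv_step n h hn t (cfg.state 0 t) (cfg.state 0 (t + 1)) ht rfl rfl (ih (by omega))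
  intro t hcov
  by_contra hlt
  push Not at hlt
  have htl : (t : ℤ) < h * (2 * h + 1) := by
    have e : (n : ℝ) = 2 * (h : ℝ) := by exact_mod_cast hn
    rw [e] at hlt
    have : ((t : ℤ) : ℝ) < ((h * (2 * h + 1) : ℤ) : ℝ) := by
      push_cast
      nlinarith
    exact_mod_cast this
  obtain ⟨l, hl, hp⟩ := hcov ((-h : ℤ) : ZMod (n + 1))
  obtain ⟨a, x, hi | hi⟩ := hinv l (by omega)
  · obtain ⟨ha, hah, hx1, hx2, _, hq, _⟩ := hi
    have := cast_inj n h x (-h) hn (by omega) (by omega) (hq.symm.trans hp)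
    omega
  · obtain ⟨ha, hah, hx1, hx2, _, hq, _⟩ := hi
    have := cast_inj n h x (-h) hn (by omega) (by omega) (hq.symm.trans hp)
    omega
end

section
/- There is a constant c > 0 such that for every lollipop graph G on n vertices (a complete graph on ⌈n/2⌉ vertices with a path of ⌊n/2⌋ further vertices attached to one of its vertices), there exist a rotor configuration whose rotor sequences are permutations of the neighbors and a starting vertex such that the rotor walk needs at least c·n³ steps to visit every vertex; in particular ṼC(G) ≥ c·n³. -/
namespace LolliAux

/-- Degree of vertex `u`. -/
def dg (n u : ℕ) : ℕ :=
  if u < (n + 1) / 2 - 1 then (n + 1) / 2 - 1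
  else if u = (n + 1) / 2 - 1 then (n + 1) / 2
  else if u = n - 1 then 1 else 2

/-- The `i`-th neighbor of `u`, in increasing order. -/
def sv (n u i : ℕ) : ℕ :=
  if u < (n + 1) / 2 then (if i < u then i else i + 1)
  else (if i = 0 then u - 1 else u + 1)

/-- The potential function. -/
def hh (n v : ℕ) : ℤ :=
  if v < (n + 1) / 2 - 1 then 0
  else 1 + (((n + 1) / 2 - 1 : ℕ) : ℤ) * ((v : ℤ) - (((n + 1) / 2 - 1 : ℕ) : ℤ))

lemma dg_pos (n u : ℕ) (hn : 4 ≤ n) : 0 < dg n u := by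
  unfold dg; split_ifs <;> omega

lemma sv_lt (n u i : ℕ) (hn : 4 ≤ n) (hu : u < n) (hi : i < dg n u) : sv n u i < n := by
  unfold dg at hi; unfold sv; split_ifs at hi ⊢ <;> omega

lemma sv_adj (n u i : ℕ) (hn : 4 ≤ n) (hu : u < n) (hi : i < dg n u) :
    LollipopAdj n ⟨u, hu⟩ ⟨sv n u i, sv_lt n u i hn hu hi⟩ := by
  unfold LollipopAdj
  simp only [ne_eq, Fin.mk.injEq]
  unfold dg at hi; unfold sv; split_ifs at hi ⊢ <;> omega

lemma sv_inj (n u i j : ℕ) (hn : 4 ≤ n) (hi : i < dg n u) (hj : j < dg n u)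
    (h : sv n u i = sv n u j) : i = j := by
  unfold dg at hi hj; unfold sv at h; split_ifs at hi hj h <;> omega

lemma sv_surj (n : ℕ) (hn : 4 ≤ n) (u v : Fin n) (h : LollipopAdj n u v) :
    ∃ i, i < dg n u.val ∧ sv n u.val i = v.val := by
  obtain ⟨u, hu⟩ := u
  obtain ⟨v, hv⟩ := v
  unfold LollipopAdj at h
  simp only [ne_eq, Fin.mk.injEq] at h ⊢
  by_cases h1 : u < (n + 1) / 2
  · refine ⟨if v < u then v else v - 1, ?_⟩
    unfold dg sv; split_ifs <;> omega
  · by_cases h2 : v < u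
    · refine ⟨0, ?_, ?_⟩
      · unfold dg; split_ifs <;> omega
      · rw [sv, if_neg h1, if_pos rfl]; omega
    · refine ⟨1, ?_, ?_⟩
      · unfold dg; split_ifs <;> omega
      · rw [sv, if_neg h1, if_neg one_ne_zero]; omega

lemma psum_nonpos (d : ℕ) (hd : 0 < d) (g : ℕ → ℤ)
    (hg : ∀ r, r ≤ d → ∑ i ∈ Finset.range r, g (i % d) ≤ 0) (N : ℕ) :
    ∑ i ∈ Finset.range N, g (i % d) ≤ 0 := by
  induction N using Nat.strong_induction_on with
  | _ N ih =>
    by_cases h : N ≤ d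
    · exact hg N h
    · obtain ⟨M, rfl⟩ : ∃ M, N = d + M := ⟨N - d, by omega⟩
      rw [Finset.sum_range_add]
      have h1 := hg d le_rfl
      have h2 := ih M (by omega)
      simp only [Nat.add_mod_left]
      linarith

lemma psum_nonpos_of (e : ℕ) (g : ℕ → ℤ) (B : ℤ) (hB : B ≤ 0)
    (h1 : ∀ i, i < e → g i ≤ B) (h2 : (e : ℤ) * B + g e ≤ 0) (N : ℕ) :
    ∑ i ∈ Finset.range N, g (i % (e + 1)) ≤ 0 := by
  apply psum_nonpos _ (Nat.succ_pos e)
  intro r hr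
  rcases Nat.lt_or_ge r (e + 1) with h | h
  · apply Finset.sum_nonpos
    intro i hi
    have hi := Finset.mem_range.1 hi
    rw [Nat.mod_eq_of_lt (by omega)]
    exact (h1 i (by omega)).trans hB
  · obtain rfl : r = e + 1 := by omega
    rw [Finset.sum_range_succ, Nat.mod_eq_of_lt (Nat.lt_succ_self e)]
    have : ∑ i ∈ Finset.range e, g (i % (e + 1)) ≤ ∑ i ∈ Finset.range e, B := by
      apply Finset.sum_le_sum
      intro i hi
      have hi := Finset.mem_range.1 hi
      rw [Nat.mod_eq_of_lt (by omega)]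
      exact h1 i hi
    simp at this
    linarith

lemma hh_lo (n v : ℕ) (h : v < (n + 1) / 2 - 1) : hh n v = 0 := if_pos h

lemma hh_hi (n v : ℕ) (h : ¬ v < (n + 1) / 2 - 1) :
    hh n v = 1 + (((n + 1) / 2 - 1 : ℕ) : ℤ) * ((v : ℤ) - (((n + 1) / 2 - 1 : ℕ) : ℤ)) :=
  if_neg h

lemma vertex_le (n u : ℕ) (hn : 4 ≤ n) (hu : u < n) (N : ℕ) :
    ∑ i ∈ Finset.range N,
      ((((n + 1) / 2 - 1 : ℕ) : ℤ) * (hh n (sv n u (i % dg n u)) - hh n u) - 1) ≤ 0 := by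
  obtain ⟨K, hK⟩ : ∃ K, K = (n + 1) / 2 - 1 := ⟨_, rfl⟩
  have hk : (n + 1) / 2 = K + 1 := by omega
  have hK1 : 1 ≤ K := by omega
  have key : ∀ (e : ℕ) (B : ℤ), dg n u = e + 1 → B ≤ 0 →
      (∀ i, i < e → (K : ℤ) * (hh n (sv n u i) - hh n u) - 1 ≤ B) →
      ((e : ℤ) * B + ((K : ℤ) * (hh n (sv n u e) - hh n u) - 1) ≤ 0) →
      ∑ i ∈ Finset.range N,
      ((((n + 1) / 2 - 1 : ℕ) : ℤ) * (hh n (sv n u (i % dg n u)) - hh n u) - 1) ≤ 0 := by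
    intro e B hd hB h1 h2
    rw [hd, ← hK]
    exact psum_nonpos_of e (fun i => (K : ℤ) * (hh n (sv n u i) - hh n u) - 1) B hB h1 h2 N
  rcases lt_trichotomy u K with h | h | h
  · apply key (K - 1) (-1) (by unfold dg; split_ifs <;> omega) (by norm_num)
    · intro i hi
      rw [hh_lo n u (by omega), hh_lo n (sv n u i) (by unfold sv; split_ifs <;> omega)]
      simp
    · have : sv n u (K - 1) = K := by unfold sv; split_ifs <;> omega
      rw [this, hh_lo n u (by omega), hh_hi n K (by omega), ← hK]
      push_cast [hK1]
      linarith
  · apply key K (-K - 1) (by unfold dg; split_ifs <;> omega) (by omega)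
    · intro i hi
      rw [hh_hi n u (by omega), hh_lo n (sv n u i) (by unfold sv; split_ifs <;> omega), ← hK, h]
      linarith
    · have : sv n u K = K + 1 := by unfold sv; split_ifs <;> omega
      rw [this, hh_hi n u (by omega), hh_hi n (K + 1) (by omega), ← hK, h]
      push_cast
      nlinarith
  · have hb : (K : ℤ) * (hh n (sv n u 0) - hh n u) - 1 = - K * K - 1 := by
      have : sv n u 0 = u - 1 := by unfold sv; split_ifs <;> omega
      rw [this, hh_hi n u (by omega), hh_hi n (u - 1) (by omega), ← hK]
      push_cast [show 1 ≤ u by omega]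
      ring
    by_cases hl : u = n - 1
    · apply key 0 0 (by subst hl; unfold dg; split_ifs <;> omega) le_rfl
      · intro i hi; omega
      · rw [hb]; push_cast; nlinarith
    · apply key 1 (- K * K - 1) (by unfold dg; split_ifs <;> omega) (by nlinarith)
      · intro i hi
        obtain rfl : i = 0 := by omega
        rw [hb]
      · have : sv n u 1 = u + 1 := by rw [sv, if_neg (by omega), if_neg one_ne_zero]
        rw [this, hh_hi n u (by omega), hh_hi n (u + 1) (by omega), ← hK]
        push_cast
        nlinarith

lemma degree_eq (n : ℕ) (hn : 4 ≤ n) (G : SimpleGraph (Fin n)) [DecidableRel G.Adj]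
    (hG : ∀ i j, G.Adj i j ↔ LollipopAdj n i j) (u : Fin n) : G.degree u = dg n u.val := by
  rw [← SimpleGraph.card_neighborFinset_eq_degree, ← Finset.card_range (dg n u.val)]
  symm
  apply Finset.card_bij
    (fun i hi => (⟨sv n u.val i, sv_lt n u.val i hn u.2 (Finset.mem_range.1 hi)⟩ : Fin n))
  · intro i hi
    rw [SimpleGraph.mem_neighborFinset, hG]
    exact sv_adj n u.val i hn u.2 (Finset.mem_range.1 hi)
  · intro i hi j hj h
    exact sv_inj n u.val i j hn (Finset.mem_range.1 hi) (Finset.mem_range.1 hj)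
      (by simpa using h)
  · intro v hv
    rw [SimpleGraph.mem_neighborFinset, hG] at hv
    obtain ⟨i, hi, h⟩ := sv_surj n hn u v hv
    exact ⟨i, Finset.mem_range.2 hi, Fin.ext h⟩

/-- The rotor configuration with increasing rotor sequences. -/
def cfg (n : ℕ) (hn : 4 ≤ n) (G : SimpleGraph (Fin n)) [DecidableRel G.Adj]
    (hG : ∀ i j, G.Adj i j ↔ LollipopAdj n i j) : PermRotorConfig G where
  s u i := ⟨sv n u.val (i % dg n u.val),
    sv_lt n u.val _ hn u.2 (Nat.mod_lt _ (dg_pos n u.val hn))⟩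
  periodic u i := by simp [degree_eq n hn G hG]
  adj u i hi := by
    rw [hG]
    exact sv_adj n u.val _ hn u.2 (Nat.mod_lt _ (dg_pos n u.val hn))
  inj u i j hi hj h := by
    rw [degree_eq n hn G hG] at hi hj
    simp only [Fin.mk.injEq, Nat.mod_eq_of_lt hi, Nat.mod_eq_of_lt hj] at h
    exact sv_inj n u.val i j hn hi hj h
  r0 _ := 0

lemma flow {V : Type*} [Fintype V] [DecidableEq V] {G : SimpleGraph V} [DecidableRel G.Adj]
    (c : PermRotorConfig G) (h0 : ∀ u, c.r0 u = 0) (x0 : V) (K : ℤ) (h : V → ℤ) (t : ℕ) :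
    ∑ u, ∑ i ∈ Finset.range ((c.state x0 t).2 u), (K * (h (c.s u i) - h u) - 1)
      = K * (h (c.pos x0 t) - h x0) - t := by
  induction t with
  | zero => simp [PermRotorConfig.state, PermRotorConfig.pos, h0]
  | succ t ih =>
    unfold PermRotorConfig.pos at ih ⊢
    simp only [PermRotorConfig.state, PermRotorConfig.step]
    generalize c.state x0 t = st at ih ⊢
    obtain ⟨x, N⟩ := st
    simp only at ih ⊢
    rw [← Finset.add_sum_erase _ _ (Finset.mem_univ x)] at ih ⊢
    have : ∑ u ∈ Finset.univ.erase x, ∑ i ∈ Finset.range (Function.update N x (N x + 1) u),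
        (K * (h (c.s u i) - h u) - 1) = ∑ u ∈ Finset.univ.erase x, ∑ i ∈ Finset.range (N u),
        (K * (h (c.s u i) - h u) - 1) := by
      apply Finset.sum_congr rfl
      intro u hu
      rw [Function.update_of_ne (Finset.ne_of_mem_erase hu)]
    rw [this, Function.update_self, Finset.sum_range_succ]
    push_cast
    linarith

end LolliAux

/-- There is a constant `c > 0` such that for every sufficiently large
lollipop graph on `n` vertices, there are a rotor configuration (with permutation rotor
sequences) and a starting vertex such that the rotor walk needs at least `c·n³` steps to
visit every vertex; in particular `ṼC(G) ≥ c·n³`. -/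
theorem detVertexCover_lollipop_ge :
    ∃ c : ℝ, 0 < c ∧ ∃ n0 : ℕ,
      ∀ n : ℕ, n0 ≤ n →
        ∀ (G : SimpleGraph (Fin n)) [DecidableRel G.Adj],
          (∀ i j, G.Adj i j ↔ LollipopAdj n i j) →
          ∃ (cfg : PermRotorConfig G) (x0 : Fin n),
            ∀ t : ℕ, cfg.coversVertices x0 t → c * (n : ℝ) ^ 3 ≤ (t : ℝ) := by
  refine ⟨1 / 64, by norm_num, 4, ?_⟩
  intro n hn G _ hG
  refine ⟨LolliAux.cfg n hn G hG, ⟨0, by omega⟩, ?_⟩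
  intro t ht
  obtain ⟨l, hl, hp⟩ := ht ⟨n - 1, by omega⟩
  have hf := LolliAux.flow (LolliAux.cfg n hn G hG) (fun _ => rfl) ⟨0, by omega⟩
    (((n + 1) / 2 - 1 : ℕ) : ℤ) (fun v => LolliAux.hh n v.val) l
  rw [hp] at hf
  have hle : ((((n + 1) / 2 - 1 : ℕ) : ℤ) * (LolliAux.hh n (n - 1) - LolliAux.hh n 0) - l) ≤ 0 := by
    rw [← hf]
    apply Finset.sum_nonpos
    intro u _
    exact LolliAux.vertex_le n u.val hn u.2 _
  rw [LolliAux.hh_lo n 0 (by omega), LolliAux.hh_hi n (n - 1) (by omega)] at hle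
  obtain ⟨K, hK⟩ : ∃ K, K = (n + 1) / 2 - 1 := ⟨_, rfl⟩
  obtain ⟨L, hL⟩ : ∃ L, n - 1 = L + K := ⟨n - 1 - K, by omega⟩
  rw [← hK, hL] at hle
  have h1 : n ≤ 4 * K := by omega
  have h2 : n ≤ 4 * L := by omega
  have h3 : K * (K * L) ≤ l := by
    have : (K : ℤ) * (K * L) ≤ l := by
      push_cast at hle
      nlinarith
    exact_mod_cast this
  have h4 : n * (n * n) ≤ (4 * K) * ((4 * K) * (4 * L)) := by gcongr
  have h5 : n ^ 3 ≤ 64 * t := by nlinarith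
  have h6 : (n : ℝ) ^ 3 ≤ 64 * t := by exact_mod_cast h5
  linarith
end
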